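/- arXiv:2504.09276 — 5 statements merged into one kernel-verified Lean document; each statement's English description precedes it below -/
import Mathlib

section
/- Let H ∈ (0,1), let W^H be a fractional Brownian motion with Hurst parameter H, and let Y_t := ∫₀ᵗ W^H_s ds. There exists a constant c_H > 0 such that P-almost surely there is an n₀ ∈ ℕ with: for all n ≥ n₀ and all 0 ≤ i ≤ 2^n − 1, (1 − δ_n)² τ_H ≤ 2^{n(4H−3)} ‖ϑ̄^Y_{2n,i}‖²_{ℓ₂} ≤ (1 + δ_n)² τ_H, where δ_n := c_H · 2^{−n/2} √(n log 2 + 2 log n). -/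
open MeasureTheory ProbabilityTheory Filter

/-- Approximated Faber–Schauder coefficient `ϑ^f_{n,k}`. -/
noncomputable def vartheta (f : ℝ → ℝ) (n k : ℕ) : ℝ :=
  (2 : ℝ) ^ ((3 * (n : ℝ)) / 2 + 3) *
    (f ((4 * k) / 2 ^ (n + 2)) - 2 * f ((4 * k + 1) / 2 ^ (n + 2))
      + 2 * f ((4 * k + 3) / 2 ^ (n + 2)) - f ((4 * k + 4) / 2 ^ (n + 2)))

/-- Squared Euclidean norm of the block `ϑ̄^f_{2n,i}`. -/
noncomputable def blockNormSq (f : ℝ → ℝ) (n i : ℕ) : ℝ :=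
  ∑ j ∈ Finset.range (2 ^ n), (vartheta f (2 * n) (2 ^ n * i + j)) ^ 2

/-- `δ_n := c_H 2^{-n/2} √(n log 2 + 2 log n)`. -/
noncomputable def deltaSeq (cH : ℝ) (n : ℕ) : ℝ :=
  cH * (2 : ℝ) ^ (-(n : ℝ) / 2) * Real.sqrt ((n : ℝ) * Real.log 2 + 2 * Real.log n)

/-- Covariance function of fractional Brownian motion with Hurst parameter `H`. -/
noncomputable def fbmCov (H s t : ℝ) : ℝ :=
  (s ^ (2 * H) + t ^ (2 * H) - |s - t| ^ (2 * H)) / 2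

/-- `W` is a fractional Brownian motion with Hurst parameter `H` on `[0,1]`:
it has a.s. continuous paths and centered Gaussian finite-dimensional distributions
with covariance `fbmCov H`. -/
def IsFBM {Ω : Type*} [MeasurableSpace Ω] (P : Measure Ω) (H : ℝ) (W : ℝ → Ω → ℝ) : Prop :=
  (∀ t, Measurable (W t)) ∧
  (∀ᵐ ω ∂P, ContinuousOn (fun t => W t ω) (Set.Icc 0 1)) ∧
  ∀ (n : ℕ) (t c : Fin n → ℝ), (∀ i, t i ∈ Set.Icc (0 : ℝ) 1) →
    Measure.map (fun ω => ∑ i, c i * W (t i) ω) P =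
      gaussianReal 0 (Real.toNNReal (∑ i, ∑ j, c i * c j * fbmCov H (t i) (t j)))

open scoped Topology

section

/-- Elementary bound for the Laplace transform of a centered `χ²` variable. -/
lemma exp_neg_div_sqrt_one_sub_le {a : ℝ} (ha : |a| ≤ 1 / 4) :
    Real.exp (-a) * √(1 / (1 - 2 * a)) ≤ Real.exp (4 * a ^ 2) := by
  obtain ⟨h1, h2⟩ := abs_le.mp ha
  have hpos : 0 < 1 - 2 * a := by linarith
  have hy : |2 * a| ≤ 1 / 2 := by rw [abs_mul, abs_two]; linarith
  have hlog := Real.abs_log_sub_add_sum_range_le (x := 2 * a) (by linarith) 1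
  have hrhs : |2 * a| ^ (1 + 1) / (1 - |2 * a|) ≤ 8 * a ^ 2 := by
    rw [div_le_iff₀ (by linarith), one_add_one_eq_two, sq_abs]
    nlinarith [sq_nonneg a]
  have hlow : -(2 * a) - 8 * a ^ 2 ≤ Real.log (1 - 2 * a) := by
    have := (abs_le.mp (hlog.trans hrhs)).1
    simp at this
    linarith
  have hs : √(1 / (1 - 2 * a)) ≤ Real.exp (a + 4 * a ^ 2) := by
    rw [Real.sqrt_le_left (Real.exp_pos _).le, ← Real.exp_nat_mul, one_div, inv_le_comm₀ hpos
      (Real.exp_pos _), ← Real.exp_neg, ← Real.le_log_iff_exp_le hpos]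
    push_cast
    linarith
  calc _ ≤ Real.exp (-a) * Real.exp (a + 4 * a ^ 2) := by gcongr
    _ = _ := by rw [← Real.exp_add]; ring_nf

/-- Laplace transform of the centered square of a centered real Gaussian variable. -/
lemma lintegral_exp_sq_sub_var_gaussianReal_le {v : NNReal} {s : ℝ} (h : |s| * v ≤ 1 / 4) :
    ∫⁻ x, ENNReal.ofReal (Real.exp (s * (x ^ 2 - v))) ∂(gaussianReal 0 v) ≤
      ENNReal.ofReal (Real.exp (4 * (s * v) ^ 2)) := by
  rcases eq_or_ne v 0 with rfl | hv
  · rw [gaussianReal_zero_var, lintegral_dirac' _ (by fun_prop)]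
    simp
  have hv' : (0 : ℝ) < v := by positivity
  have ha : |s * v| ≤ 1 / 4 := by rwa [abs_mul, abs_of_pos hv']
  have ha' := abs_le.mp ha
  set b : ℝ := (1 - 2 * (s * v)) / (2 * v) with hb
  have hbpos : 0 < b := by apply div_pos <;> linarith
  have hfun : ∀ x : ℝ, gaussianPDFReal 0 v x * Real.exp (s * (x ^ 2 - v)) =
      (√(2 * Real.pi * v))⁻¹ * Real.exp (-(s * v)) * Real.exp (-b * x ^ 2) := fun x ↦ by
    rw [gaussianPDFReal, mul_assoc, mul_assoc (√_)⁻¹, ← Real.exp_add, ← Real.exp_add]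
    congr 2
    rw [hb]; field_simp; ring
  rw [gaussianReal_of_var_ne_zero _ hv,
    lintegral_withDensity_eq_lintegral_mul _ (measurable_gaussianPDF 0 v) (by fun_prop)]
  simp_rw [Pi.mul_apply, gaussianPDF_def, ← ENNReal.ofReal_mul (gaussianPDFReal_nonneg _ _ _), hfun]
  rw [← ofReal_integral_eq_lintegral_ofReal ((integrable_exp_neg_mul_sq hbpos).const_mul _)
    (ae_of_all _ fun x ↦ by positivity)]
  apply ENNReal.ofReal_le_ofReal
  rw [integral_const_mul, integral_gaussian]
  refine le_of_eq_of_le ?_ (exp_neg_div_sqrt_one_sub_le ha)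
  rw [mul_comm (√_)⁻¹, mul_assoc]
  congr 1
  rw [← Real.sqrt_inv, ← Real.sqrt_mul (by positivity), hb]
  congr 1
  have : 1 - 2 * (s * v) ≠ 0 := by linarith
  field_simp

variable {Ω : Type*} [MeasurableSpace Ω] {P : Measure Ω}

/-- Exponential bound for the centered squared norm of a centered Gaussian vector whose covariance
matrix has absolute row sums at most `L`. -/
lemma lintegral_exp_sum_sq_sub_le {ι : Type*} [Fintype ι]
    {X : ι → Ω → ℝ} (hXm : ∀ i, Measurable (X i))
    (hX : HasGaussianLaw (fun ω i ↦ X i ω) P) (h0 : ∀ i, ∫ ω, X i ω ∂P = 0)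
    {L : ℝ} (hL : ∀ i, ∑ j, |cov[X i, X j; P]| ≤ L) {s : ℝ} (hs : |s| * L ≤ 1 / 4) :
    ∫⁻ ω, ENNReal.ofReal (Real.exp (s * (∑ i, X i ω ^ 2 - ∑ i, Var[X i; P]))) ∂P ≤
      ENNReal.ofReal (Real.exp (4 * s ^ 2 * (Fintype.card ι * L ^ 2))) := by
  classical
  have := hX.isProbabilityMeasure
  have hm : ∀ i, MemLp (X i) 2 P := fun i ↦ (hX.eval i).memLp_two
  let R : Matrix ι ι ℝ := fun i j ↦ cov[X i, X j; P]
  have hR : R.IsHermitian := by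
    ext i j; exact covariance_comm _ _
  let b := hR.eigenvectorBasis
  let μ := hR.eigenvalues
  let V : ι → Ω → ℝ := fun k ω ↦ ∑ i, b k i * X i ω
  have hcov : ∀ k l, cov[V k, V l; P] = if k = l then μ k else 0 := fun k l ↦ by
    have h1 : cov[V k, V l; P] = ∑ i, b k i * ∑ j, R i j * b l j := by
      rw [covariance_fun_sum_fun_sum (fun i ↦ (hm i).const_mul _) (fun i ↦ (hm i).const_mul _)]
      simp_rw [covariance_const_mul_left, covariance_const_mul_right, Finset.mul_sum]
      exact Finset.sum_congr rfl fun i _ ↦ Finset.sum_congr rfl fun j _ ↦ by ring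
    have h2 : ∀ i, ∑ j, R i j * b l j = μ l * b l i := fun i ↦
      congrFun (hR.mulVec_eigenvectorBasis l) i
    have h3 : ∑ i, b k i * b l i = if k = l then 1 else 0 := by
      rw [← orthonormal_iff_ite.mp b.orthonormal k l, PiLp.inner_apply]
      exact Finset.sum_congr rfl fun i _ ↦ by simp [mul_comm]
    rw [h1]
    simp_rw [h2, mul_left_comm _ (μ l), ← Finset.mul_sum, h3]
    split_ifs with hkl
    · rw [hkl, mul_one]
    · rw [mul_zero]
  have hV : HasGaussianLaw (fun ω k ↦ V k ω) P := by
    let T : (ι → ℝ) →L[ℝ] (ι → ℝ) :=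
      ContinuousLinearMap.pi fun k ↦ ∑ i, b k i • ContinuousLinearMap.proj i
    have hT : (fun ω k ↦ V k ω) = fun ω ↦ T fun i ↦ X i ω := by ext; simp [T, V]
    exact hT ▸ hX.map_fun T
  have hind : iIndepFun V P := hV.iIndepFun_of_covariance_eq_zero fun k l hkl ↦ by
    rw [hcov, if_neg hkl]
  have hvar : ∀ k, Var[V k; P] = μ k := fun k ↦ by
    rw [← covariance_self (hV.eval k).aemeasurable, hcov, if_pos rfl]
  have hμ0 : ∀ k, 0 ≤ μ k := fun k ↦ hvar k ▸ variance_nonneg _ _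
  have hμL : ∀ k, μ k ≤ L := fun k ↦ by
    have : Module.End.HasEigenvalue (Matrix.toLin' R) (μ k) := by
      refine Module.End.hasEigenvalue_of_hasEigenvector (x := b k) ⟨?_, ?_⟩
      · rw [Module.End.mem_eigenspace_iff, Matrix.toLin'_apply]
        exact hR.mulVec_eigenvectorBasis k
      · intro h
        exact b.orthonormal.ne_zero k (by ext i; exact congrFun h i)
    obtain ⟨i, hi⟩ := eigenvalue_mem_ball this
    rw [Metric.mem_closedBall, Real.dist_eq] at hi
    have h1 := (abs_le.mp hi).2
    have h2 := hL i
    rw [← Finset.add_sum_erase _ _ (Finset.mem_univ i)] at h2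
    have h3 := le_abs_self (R i i)
    simp only [Real.norm_eq_abs] at h1
    change |R i i| + ∑ j ∈ _, |R i j| ≤ L at h2
    linarith
  have hlaw : ∀ k, P.map (V k) = gaussianReal 0 (μ k).toNNReal := fun k ↦ by
    rw [(hV.eval k).map_eq_gaussianReal, hvar]
    congr
    rw [integral_finsetSum _ fun i _ ↦ ((hX.eval i).integrable.const_mul _)]
    simp [integral_const_mul, h0]
  have hsq : ∀ ω, ∑ i, X i ω ^ 2 = ∑ k, V k ω ^ 2 := fun ω ↦ by
    have h := b.sum_sq_norm_inner_right (WithLp.toLp 2 fun i ↦ X i ω)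
    rw [EuclideanSpace.norm_sq_eq] at h
    simp only [Real.norm_eq_abs, sq_abs] at h
    rw [← h]
    refine Finset.sum_congr rfl fun k _ ↦ ?_
    rw [PiLp.inner_apply]
    simp [V, mul_comm]
  have htr : ∑ i, Var[X i; P] = ∑ k, μ k := by
    have := hR.trace_eq_sum_eigenvalues
    simp only [RCLike.ofReal_real_eq_id, id] at this
    rw [← this]
    exact Finset.sum_congr rfl fun i _ ↦ (covariance_self (hX.eval i).aemeasurable).symm
  let F : ι → ℝ → ENNReal := fun k x ↦ ENNReal.ofReal (Real.exp (s * (x ^ 2 - (μ k).toNNReal)))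
  have hF : ∀ k, Measurable (F k) := fun k ↦ by fun_prop
  calc _ = ∫⁻ ω, ∏ k, F k (V k ω) ∂P := by
        refine lintegral_congr fun ω ↦ ?_
        rw [hsq, htr, ← Finset.sum_sub_distrib, Finset.mul_sum, Real.exp_sum,
          ENNReal.ofReal_prod_of_nonneg fun _ _ ↦ (Real.exp_pos _).le]
        simp [F, hμ0]
    _ = ∏ k, ∫⁻ ω, F k (V k ω) ∂P :=
        lintegral_prod_eq_prod_lintegral_of_indepFun Finset.univ _ (hind.comp F hF) fun k ↦
          (hF k).comp (Finset.measurable_sum _ fun i _ ↦ (hXm i).const_mul _)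
    _ ≤ ∏ _k : ι, ENNReal.ofReal (Real.exp (4 * s ^ 2 * L ^ 2)) := by
        refine Finset.prod_le_prod' fun k _ ↦ ?_
        rw [← lintegral_map' (hF k).aemeasurable (hV.eval k).aemeasurable, hlaw]
        have hk : |s| * (μ k).toNNReal ≤ 1 / 4 := by
          rw [Real.coe_toNNReal _ (hμ0 k)]
          exact (mul_le_mul_of_nonneg_left (hμL k) (abs_nonneg s)).trans hs
        refine (lintegral_exp_sq_sub_var_gaussianReal_le hk).trans ?_
        refine ENNReal.ofReal_le_ofReal (Real.exp_le_exp.mpr ?_)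
        rw [Real.coe_toNNReal _ (hμ0 k), mul_pow, ← mul_assoc]
        gcongr
        exacts [hμ0 k, hμL k]
    _ = _ := by
        rw [Finset.prod_const, Finset.card_univ, ← ENNReal.ofReal_pow (Real.exp_pos _).le,
          ← Real.exp_nat_mul]
        congr 2; ring

end

section

variable {Ω : Type*} [MeasurableSpace Ω] {P : Measure Ω}

/-- An almost sure limit of centered Gaussian variables with convergent variances is Gaussian. -/
lemma map_eq_gaussianReal_of_tendsto_ae [IsProbabilityMeasure P] {f : ℕ → Ω → ℝ} {g : Ω → ℝ}
    {v : ℕ → NNReal} {w : NNReal} (hf : ∀ M, Measurable (f M))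
    (hlaw : ∀ M, P.map (f M) = gaussianReal 0 (v M)) (hv : Tendsto v atTop (𝓝 w))
    (hfg : ∀ᵐ ω ∂P, Tendsto (fun M ↦ f M ω) atTop (𝓝 (g ω))) :
    P.map g = gaussianReal 0 w := by
  have hg : AEMeasurable g P :=
    aemeasurable_of_tendsto_metrizable_ae atTop (fun M ↦ (hf M).aemeasurable) hfg
  have := Measure.isProbabilityMeasure_map hg
  refine Measure.ext_of_charFun (funext fun t ↦ ?_)
  have h1 : Tendsto (fun M ↦ charFun (P.map (f M)) t) atTop (𝓝 (charFun (P.map g) t)) := by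
    simp_rw [charFun_apply_real]
    have hmap : ∀ {h : Ω → ℝ}, AEMeasurable h P → ∫ x, Complex.exp (t * x * Complex.I) ∂P.map h =
        ∫ ω, Complex.exp (t * h ω * Complex.I) ∂P := fun hh ↦
      integral_map hh (by fun_prop)
    rw [hmap hg, funext fun M ↦ hmap (hf M).aemeasurable]
    refine tendsto_integral_of_dominated_convergence (fun _ ↦ 1)
      (fun M ↦ by have := hf M; fun_prop) (integrable_const 1) (fun M ↦ ae_of_all _ fun ω ↦ ?_) ?_
    · rw [← Complex.ofReal_mul, Complex.norm_exp_ofReal_mul_I]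
    · filter_upwards [hfg] with ω hω
      have : Continuous fun x : ℝ ↦ Complex.exp (t * x * Complex.I) := by fun_prop
      exact (this.tendsto _).comp hω
  have h2 : Tendsto (fun M ↦ charFun (P.map (f M)) t) atTop (𝓝 (charFun (gaussianReal 0 w) t)) := by
    simp_rw [hlaw, charFun_gaussianReal]
    have hc : Continuous fun u : NNReal ↦
        Complex.exp (t * (0 : ℝ) * Complex.I - (u : ℝ) * t ^ 2 / 2) := by fun_prop
    exact (hc.tendsto w).comp hv
  exact tendsto_nhds_unique h1 h2

lemma fbmCov_self {H : ℝ} (hH : 0 < H) (s : ℝ) : fbmCov H s s = s ^ (2 * H) := by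
  rw [fbmCov, sub_self, abs_zero, Real.zero_rpow (by linarith)]
  ring

lemma fbmCov_comm (H s t : ℝ) : fbmCov H s t = fbmCov H t s := by
  rw [fbmCov, fbmCov, abs_sub_comm, add_comm (s ^ _)]

lemma fbmCov_nonneg {H : ℝ} (hH : 0 < H) {s t : ℝ} (hs : 0 ≤ s) (ht : 0 ≤ t) :
    0 ≤ fbmCov H s t := by
  have h1 := Real.rpow_nonneg hs (2 * H)
  have h2 := Real.rpow_nonneg ht (2 * H)
  have h : |s - t| ^ (2 * H) ≤ s ^ (2 * H) + t ^ (2 * H) := by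
    rcases le_total s t with hst | hst
    · rw [abs_of_nonpos (by linarith)]
      have := Real.rpow_le_rpow (by linarith : 0 ≤ -(s - t)) (by linarith : -(s - t) ≤ t)
        (by linarith : 0 ≤ 2 * H)
      linarith
    · rw [abs_of_nonneg (by linarith)]
      have := Real.rpow_le_rpow (by linarith : 0 ≤ s - t) (by linarith : s - t ≤ s)
        (by linarith : 0 ≤ 2 * H)
      linarith
  rw [fbmCov]
  linarith

namespace IsFBM

variable {H : ℝ} {W : ℝ → Ω → ℝ}

lemma map_sum_eq (hW : IsFBM P H W) {ι : Type*} [Fintype ι] (t c : ι → ℝ)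
    (ht : ∀ i, t i ∈ Set.Icc (0 : ℝ) 1) :
    P.map (fun ω ↦ ∑ i, c i * W (t i) ω) =
      gaussianReal 0 (∑ i, ∑ j, c i * c j * fbmCov H (t i) (t j)).toNNReal := by
  let e := (Fintype.equivFin ι).symm
  have h := hW.2.2 _ (t ∘ e) (c ∘ e) fun i ↦ ht _
  simp only [Function.comp_apply] at h
  have h1 : ∀ ω, ∑ i, c (e i) * W (t (e i)) ω = ∑ i, c i * W (t i) ω := fun ω ↦
    e.sum_comp fun i ↦ c i * W (t i) ω
  have h2 : ∑ i, ∑ j, c (e i) * c (e j) * fbmCov H (t (e i)) (t (e j)) =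
      ∑ i, ∑ j, c i * c j * fbmCov H (t i) (t j) := by
    rw [← e.sum_comp]
    exact Finset.sum_congr rfl fun i _ ↦ e.sum_comp fun j ↦ c (e i) * c j * fbmCov H (t (e i)) (t j)
  rwa [h2, funext h1] at h

lemma map_eq (hW : IsFBM P H W) (hH : 0 < H) {s : ℝ} (hs : s ∈ Set.Icc (0 : ℝ) 1) :
    P.map (W s) = gaussianReal 0 (s ^ (2 * H)).toNNReal := by
  have := hW.map_sum_eq (fun _ : Unit ↦ s) (fun _ ↦ 1) fun _ ↦ hs
  simpa [fbmCov_self hH] using this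

lemma hasGaussianLaw (hW : IsFBM P H W) {ι : Type*} [Fintype ι] (t : ι → ℝ)
    (ht : ∀ i, t i ∈ Set.Icc (0 : ℝ) 1) : HasGaussianLaw (fun ω i ↦ W (t i) ω) P := by
  classical
  refine ⟨isGaussian_of_map_eq_gaussianReal fun L ↦
    ⟨0, _, Eq.trans ?_ (hW.map_sum_eq t (fun i ↦ L fun j ↦ if i = j then 1 else 0) ht)⟩⟩
  rw [Measure.map_map (by fun_prop) (measurable_pi_lambda _ fun i ↦ hW.1 _)]
  congr 1
  ext ω
  exact (L.toLinearMap.pi_apply_eq_sum_univ _).trans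
    (Finset.sum_congr rfl fun i _ ↦ mul_comm _ _)

lemma memLp_two (hW : IsFBM P H W) {s : ℝ} (hs : s ∈ Set.Icc (0 : ℝ) 1) : MemLp (W s) 2 P :=
  ((hW.hasGaussianLaw (fun _ : Unit ↦ s) fun _ ↦ hs).eval ()).memLp_two

lemma integral_eq_zero (hW : IsFBM P H W) (hH : 0 < H) {s : ℝ} (hs : s ∈ Set.Icc (0 : ℝ) 1) :
    ∫ ω, W s ω ∂P = 0 := by
  rw [← integral_map (f := fun x ↦ x) (hW.1 s).aemeasurable (by fun_prop), hW.map_eq hH hs,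
    integral_id_gaussianReal]

lemma variance_eq (hW : IsFBM P H W) (hH : 0 < H) {s : ℝ} (hs : s ∈ Set.Icc (0 : ℝ) 1) :
    Var[W s; P] = s ^ (2 * H) := by
  have h := variance_id_map (hW.1 s).aemeasurable (μ := P)
  rw [hW.map_eq hH hs, variance_id_gaussianReal,
    Real.coe_toNNReal _ (Real.rpow_nonneg hs.1 _)] at h
  exact h.symm

lemma covariance_eq [IsProbabilityMeasure P] (hW : IsFBM P H W) (hH : 0 < H) {s t : ℝ}
    (hs : s ∈ Set.Icc (0 : ℝ) 1) (ht : t ∈ Set.Icc (0 : ℝ) 1) :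
    cov[W s, W t; P] = fbmCov H s t := by
  have hmap := hW.map_sum_eq ![s, t] ![1, 1] fun i ↦ by fin_cases i <;> assumption
  have hpos : 0 ≤ fbmCov H s s + fbmCov H s t + (fbmCov H t s + fbmCov H t t) := by
    have := fun {a b : ℝ} (ha : 0 ≤ a) (hb : 0 ≤ b) ↦ fbmCov_nonneg hH ha hb
    have := this hs.1 hs.1
    have := fbmCov_nonneg hH hs.1 ht.1
    have := fbmCov_nonneg hH ht.1 hs.1
    have := fbmCov_nonneg hH ht.1 ht.1
    linarith
  have hvar : Var[W s + W t; P] =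
      fbmCov H s s + fbmCov H s t + (fbmCov H t s + fbmCov H t t) := by
    rw [← variance_id_map ((hW.1 s).add (hW.1 t)).aemeasurable]
    have : W s + W t = fun ω ↦ ∑ i : Fin 2, ![1, 1] i * W (![s, t] i) ω := by
      ext; simp [Fin.sum_univ_two]
    rw [this, hmap, variance_id_gaussianReal]
    simpa [Fin.sum_univ_two] using hpos
  rw [variance_add (hW.memLp_two hs) (hW.memLp_two ht), hW.variance_eq hH hs,
    hW.variance_eq hH ht, fbmCov_self hH, fbmCov_self hH, fbmCov_comm H t s] at hvar
  linarith

end IsFBM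

end

/-- A double difference built from weights with two vanishing moments kills cubic polynomials. -/
lemma sum_sum_mul_add_sub_pow_eq_zero {ι : Type*} [Fintype ι] {g a : ι → ℝ}
    (h0 : ∑ p, g p = 0) (h1 : ∑ p, g p * a p = 0) (b : ℝ) {k : ℕ} (hk : k ≤ 3) :
    ∑ p, ∑ q, g p * g q * (b + (a p - a q)) ^ k = 0 := by
  have hinner : ∃ A B : ℝ, ∀ p, ∑ q, g q * (b + (a p - a q)) ^ k = A + B * a p := by
    interval_cases k
    · exact ⟨0, 0, fun p ↦ by simp [h0]⟩
    · refine ⟨0, 0, fun p ↦ ?_⟩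
      calc _ = (b + a p) * ∑ q, g q - ∑ q, g q * a q := by
            rw [Finset.mul_sum, ← Finset.sum_sub_distrib]
            exact Finset.sum_congr rfl fun q _ ↦ by ring
        _ = _ := by rw [h0, h1]; ring
    · refine ⟨∑ q, g q * a q ^ 2, 0, fun p ↦ ?_⟩
      calc _ = (b + a p) ^ 2 * ∑ q, g q - 2 * (b + a p) * ∑ q, g q * a q
              + ∑ q, g q * a q ^ 2 := by
            rw [Finset.mul_sum, Finset.mul_sum, ← Finset.sum_sub_distrib, ← Finset.sum_add_distrib]
            exact Finset.sum_congr rfl fun q _ ↦ by ring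
        _ = _ := by rw [h0, h1]; ring
    · refine ⟨3 * b * ∑ q, g q * a q ^ 2 - ∑ q, g q * a q ^ 3, 3 * ∑ q, g q * a q ^ 2,
        fun p ↦ ?_⟩
      calc _ = (b + a p) ^ 3 * ∑ q, g q - 3 * (b + a p) ^ 2 * ∑ q, g q * a q
              + 3 * (b + a p) * ∑ q, g q * a q ^ 2 - ∑ q, g q * a q ^ 3 := by
            rw [Finset.mul_sum, Finset.mul_sum, Finset.mul_sum, ← Finset.sum_sub_distrib,
              ← Finset.sum_add_distrib, ← Finset.sum_sub_distrib]
            exact Finset.sum_congr rfl fun q _ ↦ by ring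
        _ = _ := by rw [h0, h1]; ring
  obtain ⟨A, B, hAB⟩ := hinner
  calc _ = ∑ p, g p * ∑ q, g q * (b + (a p - a q)) ^ k := by
        simp_rw [Finset.mul_sum, mul_assoc]
    _ = A * ∑ p, g p + B * ∑ p, g p * a p := by
        rw [Finset.mul_sum, Finset.mul_sum, ← Finset.sum_add_distrib]
        exact Finset.sum_congr rfl fun p _ ↦ by rw [hAB]; ring
    _ = 0 := by rw [h0, h1]; ring

lemma norm_iteratedDerivWithin_four_rpow_le {r x y : ℝ} (hr : r ∈ Set.Ioo (0 : ℝ) 2) (hx : 8 ≤ x)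
    (hy : y ∈ Set.Icc (x - 4) (x + 4)) :
    ‖iteratedDerivWithin 4 (fun u : ℝ ↦ u ^ r) (Set.Icc (x - 4) (x + 4)) y‖ ≤
      12 / (x - 4) ^ 2 := by
  obtain ⟨hr0, hr2⟩ := hr
  have hy0 : 0 < y := by linarith [hy.1]
  rw [iteratedDerivWithin_eq_iteratedDeriv (uniqueDiffOn_Icc (by linarith))
    (Real.contDiffAt_rpow_const_of_ne hy0.ne') hy, iteratedDeriv_eq_iterate,
    Real.iter_deriv_rpow_const, norm_mul]
  have h1 : ‖(descPochhammer ℝ 4).eval r‖ ≤ 12 := by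
    have : (descPochhammer ℝ 4).eval r = r * (r - 1) * (r - 2) * (r - 3) := by
      simp [descPochhammer_succ_right]
    rw [this, norm_mul, norm_mul, norm_mul]
    have e1 : ‖r‖ ≤ 2 := abs_le.mpr ⟨by linarith, by linarith⟩
    have e2 : ‖r - 1‖ ≤ 1 := abs_le.mpr ⟨by linarith, by linarith⟩
    have e3 : ‖r - 2‖ ≤ 2 := abs_le.mpr ⟨by linarith, by linarith⟩
    have e4 : ‖r - 3‖ ≤ 3 := abs_le.mpr ⟨by linarith, by linarith⟩
    calc _ ≤ (2 : ℝ) * 1 * 2 * 3 := by gcongr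
      _ = 12 := by norm_num
  have h2 : ‖y ^ (r - (4 : ℕ))‖ ≤ 1 / (x - 4) ^ 2 := by
    rw [Real.norm_of_nonneg (Real.rpow_nonneg hy0.le _)]
    calc y ^ (r - (4 : ℕ)) ≤ y ^ (-2 : ℝ) :=
          Real.rpow_le_rpow_of_exponent_le (by linarith [hy.1]) (by push_cast; linarith)
      _ ≤ (x - 4) ^ (-2 : ℝ) :=
          Real.rpow_le_rpow_of_nonpos (by linarith) hy.1 (by norm_num)
      _ = _ := by
          rw [Real.rpow_neg (by linarith), one_div]
          norm_cast
  calc _ ≤ 12 * (1 / (x - 4) ^ 2) := by gcongr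
    _ = _ := by ring

/-- Quadratic decay of the double difference of `u ↦ u ^ r` away from the origin. -/
lemma abs_sum_sum_mul_rpow_le {ι : Type*} [Fintype ι] {g a : ι → ℝ}
    (h0 : ∑ p, g p = 0) (h1 : ∑ p, g p * a p = 0) (hg : ∀ p, |g p| ≤ 1)
    (ha : ∀ p, a p ∈ Set.Icc (0 : ℝ) 4) {r x : ℝ} (hr : r ∈ Set.Ioo (0 : ℝ) 2) (hx : 8 ≤ x) :
    |∑ p, ∑ q, g p * g q * (x + (a p - a q)) ^ r| ≤
      Fintype.card ι ^ 2 * (8192 / (x - 4) ^ 2) := by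
  set S := Set.Icc (x - 4) (x + 4) with hS
  set T : ℝ → ℝ := taylorWithinEval (fun u : ℝ ↦ u ^ r) 3 S (x - 4) with hT
  have hrem : ∀ y ∈ S, |y ^ r - T y| ≤ 8192 / (x - 4) ^ 2 := fun y hy ↦ by
    have hcont : ContDiffOn ℝ (3 + 1) (fun u : ℝ ↦ u ^ r) S := fun u hu ↦
      (Real.contDiffAt_rpow_const_of_ne (by linarith [hu.1] : 0 < u).ne').contDiffWithinAt
    have h := taylor_mean_remainder_bound (n := 3) (by linarith) hcont hy
      fun u hu ↦ norm_iteratedDerivWithin_four_rpow_le hr hx hu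
    have hy4 : (y - (x - 4)) ^ 4 ≤ 8 ^ 4 :=
      pow_le_pow_left₀ (by linarith [hy.1]) (by linarith [hy.2]) 4
    refine h.trans ?_
    have : (Nat.factorial 3 : ℝ) = 6 := by norm_num [Nat.factorial]
    rw [this]
    calc _ ≤ 12 / (x - 4) ^ 2 * 8 ^ 4 / 6 := by gcongr
      _ = _ := by ring
  have hpoly : ∑ p, ∑ q, g p * g q * T (x + (a p - a q)) = 0 := by
    have hexp : ∀ p q, g p * g q * T (x + (a p - a q)) = ∑ k ∈ Finset.range 4,
        ((k.factorial : ℝ)⁻¹ * iteratedDerivWithin k (fun u : ℝ ↦ u ^ r) S (x - 4)) *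
          (g p * g q * (4 + (a p - a q)) ^ k) := fun p q ↦ by
      rw [hT, taylor_within_apply, Finset.mul_sum]
      refine Finset.sum_congr rfl fun k _ ↦ ?_
      rw [smul_eq_mul, show x + (a p - a q) - (x - 4) = 4 + (a p - a q) by ring]
      ring
    simp_rw [hexp]
    rw [Finset.sum_congr rfl fun p _ ↦ Finset.sum_comm, Finset.sum_comm]
    refine Finset.sum_eq_zero fun k hk ↦ ?_
    simp_rw [← Finset.mul_sum]
    rw [sum_sum_mul_add_sub_pow_eq_zero h0 h1 4 (by simpa [Nat.lt_succ_iff] using hk), mul_zero]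
  have hmem : ∀ p q, x + (a p - a q) ∈ S := fun p q ↦
    ⟨by linarith [(ha p).1, (ha q).2], by linarith [(ha p).2, (ha q).1]⟩
  calc _ = |∑ p, ∑ q, g p * g q * ((x + (a p - a q)) ^ r - T (x + (a p - a q)))| := by
        simp_rw [mul_sub, Finset.sum_sub_distrib]
        rw [hpoly, sub_zero]
    _ ≤ ∑ p, ∑ q, |g p * g q * ((x + (a p - a q)) ^ r - T (x + (a p - a q)))| :=
        (Finset.abs_sum_le_sum_abs _ _).trans
          (Finset.sum_le_sum fun p _ ↦ Finset.abs_sum_le_sum_abs _ _)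
    _ ≤ ∑ _p : ι, ∑ _q : ι, 8192 / (x - 4) ^ 2 := by
        refine Finset.sum_le_sum fun p _ ↦ Finset.sum_le_sum fun q _ ↦ ?_
        rw [abs_mul, abs_mul]
        calc _ ≤ 1 * 1 * (8192 / (x - 4) ^ 2) := by
              gcongr
              exacts [hg p, hg q, hrem _ (hmem p q)]
          _ = _ := by ring
    _ = _ := by simp; ring

/-- Signs of the four quarters of a dyadic interval in the second-order wavelet difference. -/
def quarterSign : Fin 4 → ℝ := ![-1, 1, 1, -1]

/-- Left endpoints of the `M`-fold subdivision of the four unit quarters of `[0, 4]`. -/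
noncomputable def quarterNode (M : ℕ) (p : Fin M × Fin 4) : ℝ := (p.2 : ℕ) + (p.1 : ℕ) / (M : ℝ)

/-- Covariance, at lag `d`, of the normalized Riemann sums of the coefficients `ϑ`. -/
noncomputable def nodeCov (H : ℝ) (M : ℕ) (d : ℤ) : ℝ :=
  -((2 : ℝ) ^ (1 - 4 * H) / M ^ 2) * ∑ p : Fin M × Fin 4, ∑ q : Fin M × Fin 4,
    quarterSign p.2 * quarterSign q.2 * |4 * d + (quarterNode M p - quarterNode M q)| ^ (2 * H)

lemma abs_quarterSign (r : Fin 4) : |quarterSign r| = 1 := by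
  fin_cases r <;> simp [quarterSign]

lemma sum_quarterSign (M : ℕ) : ∑ p : Fin M × Fin 4, quarterSign p.2 = 0 := by
  simp [Fintype.sum_prod_type, Fin.sum_univ_four, quarterSign]

lemma sum_quarterSign_mul_quarterNode (M : ℕ) :
    ∑ p : Fin M × Fin 4, quarterSign p.2 * quarterNode M p = 0 := by
  rw [Fintype.sum_prod_type]
  refine Finset.sum_eq_zero fun i _ ↦ ?_
  simp only [Fin.sum_univ_four, quarterSign, quarterNode]
  simp
  ring

lemma quarterNode_mem_Icc (M : ℕ) (p : Fin M × Fin 4) : quarterNode M p ∈ Set.Icc (0 : ℝ) 4 := by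
  have h1 : ((p.1 : ℕ) : ℝ) / M ≤ 1 :=
    div_le_one_of_le₀ (by exact_mod_cast p.1.2.le) (by positivity)
  have h2 : ((p.2 : ℕ) : ℝ) ≤ 3 := by exact_mod_cast Nat.lt_succ_iff.mp p.2.2
  constructor
  · unfold quarterNode; positivity
  · unfold quarterNode; linarith

lemma nodeCov_neg (H : ℝ) (M : ℕ) (d : ℤ) : nodeCov H M (-d) = nodeCov H M d := by
  unfold nodeCov
  rw [Finset.sum_comm]
  congr 1
  refine Finset.sum_congr rfl fun p _ ↦ Finset.sum_congr rfl fun q _ ↦ ?_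
  rw [mul_comm (quarterSign _), ← abs_neg]
  congr 3
  push_cast
  ring

lemma abs_nodeCov_le {H : ℝ} (hH : H ∈ Set.Ioo (0 : ℝ) 1) (M : ℕ) (d : ℤ) :
    |nodeCov H M d| ≤ 147456 / (1 + |(d : ℝ)|) ^ 2 := by
  wlog hd : 0 ≤ d generalizing d
  · have := this (-d) (by omega)
    rwa [nodeCov_neg, Int.cast_neg, abs_neg] at this
  obtain ⟨hH0, hH1⟩ := hH
  have hd' : (0 : ℝ) ≤ d := by exact_mod_cast hd
  rw [abs_of_nonneg hd']
  rcases Nat.eq_zero_or_pos M with rfl | hM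
  · rw [nodeCov]; simp; positivity
  have hcard : (Fintype.card (Fin M × Fin 4) : ℝ) = 4 * M := by simp [mul_comm]
  have hpow : (2 : ℝ) ^ (1 - 4 * H) ≤ 2 := by
    calc (2 : ℝ) ^ (1 - 4 * H) ≤ 2 ^ (1 : ℝ) :=
          Real.rpow_le_rpow_of_exponent_le (by norm_num) (by linarith)
      _ = 2 := Real.rpow_one 2
  have hM' : (0 : ℝ) < M := by exact_mod_cast hM
  have hcoef : ∀ C : ℝ, 0 ≤ C → |(-((2 : ℝ) ^ (1 - 4 * H) / M ^ 2))| * ((4 * M) ^ 2 * C) =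
      2 ^ (1 - 4 * H) * (16 * C) := fun C _ ↦ by
    rw [abs_neg, abs_of_pos (by positivity)]
    field_simp
    ring
  rcases le_or_gt 2 d with h2 | h2
  · have h2' : (2 : ℝ) ≤ d := by exact_mod_cast h2
    have hpos : ∀ p q : Fin M × Fin 4, |4 * (d : ℝ) + (quarterNode M p - quarterNode M q)| =
        4 * d + (quarterNode M p - quarterNode M q) := fun p q ↦ abs_of_nonneg <| by
      linarith [(quarterNode_mem_Icc M p).1, (quarterNode_mem_Icc M q).2]
    have h := abs_sum_sum_mul_rpow_le (sum_quarterSign M) (sum_quarterSign_mul_quarterNode M)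
      (fun p ↦ (abs_quarterSign p.2).le) (quarterNode_mem_Icc M)
      (r := 2 * H) (x := 4 * d) ⟨by linarith, by linarith⟩ (by linarith)
    rw [hcard] at h
    simp_rw [nodeCov, hpos]
    rw [abs_mul]
    refine (mul_le_mul_of_nonneg_left h (abs_nonneg _)).trans ?_
    rw [hcoef _ (by positivity)]
    calc _ ≤ 2 * (16 * (8192 / (4 * (d : ℝ) - 4) ^ 2)) := by gcongr
      _ ≤ _ := by
        have hd1 : 0 < (4 * (d : ℝ) - 4) ^ 2 := by
          apply pow_pos; linarith
        rw [mul_div_assoc', mul_div_assoc', div_le_div_iff₀ hd1 (by positivity)]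
        nlinarith [mul_nonneg (by linarith : (0 : ℝ) ≤ d - 2) (by linarith : (0 : ℝ) ≤ d - 2)]
  · have h1 : (d : ℝ) ≤ 1 := by exact_mod_cast Int.lt_add_one_iff.mp h2
    have hterm : ∀ p q : Fin M × Fin 4, |quarterSign p.2 * quarterSign q.2 *
        |4 * (d : ℝ) + (quarterNode M p - quarterNode M q)| ^ (2 * H)| ≤ 64 := fun p q ↦ by
      rw [abs_mul, abs_mul, abs_quarterSign, abs_quarterSign, one_mul, one_mul,
        abs_of_nonneg (Real.rpow_nonneg (abs_nonneg _) _)]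
      have h8 : |4 * (d : ℝ) + (quarterNode M p - quarterNode M q)| ≤ 8 := abs_le.mpr
        ⟨by linarith [(quarterNode_mem_Icc M p).1, (quarterNode_mem_Icc M q).2],
          by linarith [(quarterNode_mem_Icc M q).1, (quarterNode_mem_Icc M p).2]⟩
      calc _ ≤ (8 : ℝ) ^ (2 * H) := Real.rpow_le_rpow (abs_nonneg _) h8 (by linarith)
        _ ≤ 8 ^ (2 : ℝ) := Real.rpow_le_rpow_of_exponent_le (by norm_num) (by linarith)
        _ = 64 := by norm_num
    rw [nodeCov, abs_mul]
    calc _ ≤ |(-((2 : ℝ) ^ (1 - 4 * H) / M ^ 2))| *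
          ∑ _p : Fin M × Fin 4, ∑ _q : Fin M × Fin 4, (64 : ℝ) := by
          gcongr
          exact (Finset.abs_sum_le_sum_abs _ _).trans (Finset.sum_le_sum fun p _ ↦
            (Finset.abs_sum_le_sum_abs _ _).trans (Finset.sum_le_sum fun q _ ↦ hterm p q))
      _ = |(-((2 : ℝ) ^ (1 - 4 * H) / M ^ 2))| * ((4 * M) ^ 2 * 64) := by simp; ring_nf; simp
      _ ≤ 2 * (16 * 64) := by rw [hcoef _ (by norm_num)]; gcongr
      _ ≤ _ := by
        rw [le_div_iff₀ (by positivity)]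
        nlinarith

/-- The row sums of the covariances `nodeCov` are uniformly bounded. -/
lemma exists_sum_abs_nodeCov_le {H : ℝ} (hH : H ∈ Set.Ioo (0 : ℝ) 1) :
    ∃ L : ℝ, 0 < L ∧ ∀ (M N : ℕ) (i : Fin N),
      ∑ j : Fin N, |nodeCov H M ((i : ℕ) - (j : ℕ))| ≤ L := by
  have hnat : Summable fun n : ℕ ↦ 147456 / (1 + (n : ℝ)) ^ 2 := by
    have h := ((summable_nat_add_iff 1).mpr (Real.summable_one_div_nat_pow.mpr one_lt_two))
    refine (h.mul_left 147456).congr fun n ↦ ?_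
    push_cast
    rw [add_comm (n : ℝ)]
    ring
  have hs : Summable fun d : ℤ ↦ 147456 / (1 + |(d : ℝ)|) ^ 2 :=
    Summable.of_nat_of_neg (by simpa using hnat) (by simpa using hnat)
  refine ⟨∑' d : ℤ, 147456 / (1 + |(d : ℝ)|) ^ 2, ?_, fun M N i ↦ ?_⟩
  · exact hs.tsum_pos (fun d ↦ by positivity) 0 (by positivity)
  have hinj : Function.Injective fun j : Fin N ↦ ((i : ℕ) - (j : ℕ) : ℤ) := fun j k hjk ↦ by
    ext; simp at hjk; exact hjk
  calc _ ≤ ∑ j : Fin N, 147456 / (1 + |((((i : ℕ) - (j : ℕ) : ℤ)) : ℝ)|) ^ 2 :=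
        Finset.sum_le_sum fun j _ ↦ abs_nodeCov_le hH M _
    _ = ∑ d ∈ Finset.univ.map ⟨_, hinj⟩, 147456 / (1 + |(d : ℝ)|) ^ 2 := by
        rw [Finset.sum_map]; rfl
    _ ≤ _ := hs.sum_le_tsum _ fun d _ ↦ by positivity

/-- Left Riemann sums of a continuous function converge to its integral. -/
lemma tendsto_riemannSum_Icc {f : ℝ → ℝ} {a h : ℝ} (hh : 0 < h)
    (hf : ContinuousOn f (Set.Icc a (a + h))) :
    Tendsto (fun M : ℕ ↦ h / M * ∑ p : Fin M, f (a + h * ((p : ℕ) / (M : ℝ)))) atTop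
      (𝓝 (∫ x in a..(a + h), f x)) := by
  rw [Metric.tendsto_atTop]
  intro ε hε
  have huc := isCompact_Icc.uniformContinuousOn_of_continuous hf
  rw [Metric.uniformContinuousOn_iff] at huc
  obtain ⟨δ, hδ, hfδ⟩ := huc (ε / (2 * h)) (by positivity)
  obtain ⟨M₀, hM₀⟩ := exists_nat_gt (h / δ)
  refine ⟨M₀ + 1, fun M hM ↦ ?_⟩
  have hMpos : (0 : ℝ) < M := by exact_mod_cast (by omega : 0 < M)
  have hmesh : h / M < δ := by
    rw [div_lt_comm₀ hMpos hδ]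
    exact hM₀.trans_le (by exact_mod_cast (by omega : M₀ ≤ M))
  let x : ℕ → ℝ := fun p ↦ a + h * (p / M)
  have hstep : ∀ p, x (p + 1) = x p + h / M := fun p ↦ by simp only [x]; push_cast; ring
  have hx0 : x 0 = a := by simp [x]
  have hxM : x M = a + h := by simp [x, hMpos.ne']
  have hlow : ∀ p, a ≤ x p := fun p ↦ by
    have : 0 ≤ h * (p / M) := by positivity
    simp only [x]; linarith
  have hup : ∀ p, p ≤ M → x p ≤ a + h := fun p hp ↦ by
    have : (p : ℝ) / M ≤ 1 := div_le_one_of_le₀ (by exact_mod_cast hp) hMpos.le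
    simp only [x]; nlinarith
  have hle : ∀ p, x p ≤ x (p + 1) := fun p ↦ by
    rw [hstep]; linarith [div_pos hh hMpos]
  have hsub : ∀ p < M, Set.uIcc (x p) (x (p + 1)) ⊆ Set.Icc a (a + h) := fun p hp ↦ by
    rw [Set.uIcc_of_le (hle p)]
    exact Set.Icc_subset_Icc (hlow p) (hup _ hp)
  have hfint : ∀ p < M, IntervalIntegrable f volume (x p) (x (p + 1)) := fun p hp ↦
    (hf.mono (hsub p hp)).intervalIntegrable
  have hsum := intervalIntegral.sum_integral_adjacent_intervals hfint
  rw [hx0, hxM] at hsum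
  rw [← hsum, Fin.sum_univ_eq_sum_range (fun p ↦ f (a + h * (p / (M : ℝ)))), Finset.mul_sum,
    Real.dist_eq, ← Finset.sum_sub_distrib]
  have hterm : ∀ p ∈ Finset.range M,
      |h / M * f (x p) - ∫ u in x p..x (p + 1), f u| ≤ ε / (2 * h) * (h / M) := fun p hp ↦ by
    have hp' := Finset.mem_range.mp hp
    have hconst : h / M * f (x p) = ∫ _u in x p..x (p + 1), f (x p) := by
      rw [intervalIntegral.integral_const, hstep, smul_eq_mul]; ring
    rw [hconst, ← intervalIntegral.integral_sub (by simp) (hfint p hp')]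
    have := intervalIntegral.norm_integral_le_of_norm_le_const (a := x p) (b := x (p + 1))
      (f := fun u ↦ f (x p) - f u) (C := ε / (2 * h)) fun u hu ↦ by
        rw [Set.uIoc_of_le (hle p)] at hu
        refine (hfδ (x p) ?_ u ?_ ?_).le
        · exact hsub p hp' Set.left_mem_uIcc
        · exact hsub p hp' (Set.Ioc_subset_Icc_self.trans Set.Icc_subset_uIcc hu)
        · rw [Real.dist_eq, abs_sub_comm, abs_of_nonneg (by linarith [hu.1])]
          linarith [hu.2, hstep p]
    rwa [hstep, add_sub_cancel_left, abs_of_pos (div_pos hh hMpos), ← hstep] at this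
  calc _ ≤ ∑ p ∈ Finset.range M, |h / M * f (x p) - ∫ u in x p..x (p + 1), f u| :=
        Finset.abs_sum_le_sum_abs _ _
    _ ≤ ∑ _p ∈ Finset.range M, ε / (2 * h) * (h / M) := Finset.sum_le_sum hterm
    _ = ε / 2 := by simp; field_simp
    _ < ε := by linarith

/-- The coefficient `ϑ^f_{m,k}` rescaled so that its variance for integrated fractional Brownian
motion does not depend on `m` and `k`. -/
noncomputable def normCoeff (H : ℝ) (f : ℝ → ℝ) (m k : ℕ) : ℝ :=
  (2 : ℝ) ^ (m * (H - 1 / 2)) * vartheta f m k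

/-- Riemann sum approximation of `normCoeff` for a primitive of `f`. -/
noncomputable def nodeSum (H : ℝ) (M : ℕ) (f : ℝ → ℝ) (m k : ℕ) : ℝ :=
  ∑ p : Fin M × Fin 4, (2 : ℝ) ^ (m * H + 1) / M * quarterSign p.2 *
    f ((4 * k + quarterNode M p) / 2 ^ (m + 2))

lemma node_mem_Icc {m k : ℕ} (hk : k < 2 ^ m) {x : ℝ} (hx : x ∈ Set.Icc (0 : ℝ) 4) :
    (4 * k + x) / 2 ^ (m + 2) ∈ Set.Icc (0 : ℝ) 1 := by
  have h : (k : ℝ) + 1 ≤ 2 ^ m := by exact_mod_cast hk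
  refine ⟨div_nonneg (by linarith [hx.1, k.cast_nonneg (α := ℝ)]) (by positivity), ?_⟩
  rw [div_le_one (by positivity), pow_add]
  linarith [hx.2]

lemma tendsto_nodeSum (H : ℝ) {f : ℝ → ℝ} (hf : ContinuousOn f (Set.Icc 0 1)) {m k : ℕ}
    (hk : k < 2 ^ m) :
    Tendsto (fun M ↦ nodeSum H M f m k) atTop
      (𝓝 (normCoeff H (fun t ↦ ∫ s in (0 : ℝ)..t, f s) m k)) := by
  set h : ℝ := 1 / 2 ^ (m + 2) with hh
  have hpos : 0 < h := by positivity
  let a : ℕ → ℝ := fun r ↦ (4 * k + r) / 2 ^ (m + 2)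
  have ha : ∀ r ≤ 4, a r ∈ Set.Icc (0 : ℝ) 1 := fun r hr ↦
    node_mem_Icc hk ⟨by positivity, by exact_mod_cast hr⟩
  have hstep : ∀ r, a (r + 1) = a r + h := fun r ↦ by simp only [a, hh]; push_cast; ring
  have hfint : ∀ r ≤ 4, IntervalIntegrable f volume 0 (a r) := fun r hr ↦
    (hf.mono (by
      rw [Set.uIcc_of_le (ha r hr).1]
      exact Set.Icc_subset_Icc le_rfl (ha r hr).2)).intervalIntegrable
  set I : ℕ → ℝ := fun r ↦ ∫ s in (0 : ℝ)..a r, f s with hI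
  have hriem : ∀ r < 4, Tendsto
      (fun M : ℕ ↦ h / M * ∑ p : Fin M, f (a r + h * ((p : ℕ) / (M : ℝ)))) atTop
      (𝓝 (I (r + 1) - I r)) := fun r hr ↦ by
    rw [hI]
    simp only
    rw [intervalIntegral.integral_interval_sub_left (hfint _ hr) (hfint _ hr.le), hstep]
    refine tendsto_riemannSum_Icc hpos (hf.mono ?_)
    rw [← hstep]
    exact Set.Icc_subset_Icc (ha r hr.le).1 (ha (r + 1) hr).2
  have hlim := ((((hriem 1 (by norm_num)).add (hriem 2 (by norm_num))).sub
    (hriem 0 (by norm_num))).sub (hriem 3 (by norm_num))).const_mul ((2 : ℝ) ^ (m * H + 1) / h)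
  convert hlim using 2 with M
  · unfold nodeSum
    rw [Fintype.sum_prod_type_right]
    simp only [Fin.sum_univ_four, ← Finset.mul_sum]
    have hnode : ∀ (p : Fin M) (r : Fin 4), (4 * k + quarterNode M (p, r)) / 2 ^ (m + 2) =
        a (r : ℕ) + h * ((p : ℕ) / (M : ℝ)) := fun p r ↦ by
      simp only [quarterNode, a, hh]; ring
    simp only [hnode]
    simp [quarterSign]
    field_simp
    ring
  · have hc : (2 : ℝ) ^ (m * (H - 1 / 2)) * 2 ^ (3 * (m : ℝ) / 2 + 3) = 2 ^ (m * H + 1) / h := by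
      rw [hh, div_div_eq_mul_div, div_one, ← Real.rpow_natCast, ← Real.rpow_add two_pos,
        ← Real.rpow_add two_pos]
      congr 1
      push_cast
      ring
    rw [normCoeff, vartheta, ← mul_assoc, hc]
    congr 1
    simp only [hI, a]
    push_cast
    rw [add_zero]
    norm_num
    ring

/-- Rescaling identity between block norms and normalized coefficients. -/
lemma rpow_mul_blockNormSq (H : ℝ) (f : ℝ → ℝ) (n i : ℕ) :
    (2 : ℝ) ^ ((n : ℝ) * (4 * H - 3)) * blockNormSq f n i =
      (∑ j : Fin (2 ^ n), normCoeff H f (2 * n) (2 ^ n * i + j) ^ 2) / 2 ^ n := by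
  rw [Fin.sum_univ_eq_sum_range (fun j ↦ normCoeff H f (2 * n) (2 ^ n * i + j) ^ 2), blockNormSq,
    Finset.mul_sum, Finset.sum_div]
  refine Finset.sum_congr rfl fun j _ ↦ ?_
  rw [normCoeff, mul_pow, mul_div_right_comm]
  congr 1
  rw [← Real.rpow_natCast, ← Real.rpow_natCast, ← Real.rpow_mul two_pos.le,
    ← Real.rpow_sub two_pos]
  congr 1
  push_cast
  ring

namespace IsFBM

variable {Ω : Type*} [MeasurableSpace Ω] {P : Measure Ω} {H : ℝ} {W : ℝ → Ω → ℝ}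

lemma measurable_nodeSum (hW : IsFBM P H W) (M m k : ℕ) :
    Measurable fun ω ↦ nodeSum H M (fun t ↦ W t ω) m k :=
  Finset.measurable_sum _ fun _ _ ↦ (hW.1 _).const_mul _

lemma hasGaussianLaw_nodeSum (hW : IsFBM P H W) (M m : ℕ) {N : ℕ} {k : Fin N → ℕ}
    (hk : ∀ i, k i < 2 ^ m) :
    HasGaussianLaw (fun ω i ↦ nodeSum H M (fun t ↦ W t ω) m (k i)) P := by
  let T : (Fin N × (Fin M × Fin 4) → ℝ) →L[ℝ] (Fin N → ℝ) := ContinuousLinearMap.pi fun i ↦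
    ∑ p : Fin M × Fin 4, ((2 : ℝ) ^ (m * H + 1) / M * quarterSign p.2) •
      ContinuousLinearMap.proj (i, p)
  have h := (hW.hasGaussianLaw
    (fun x : Fin N × (Fin M × Fin 4) ↦ (4 * k x.1 + quarterNode M x.2) / 2 ^ (m + 2))
    fun x ↦ node_mem_Icc (hk x.1) (quarterNode_mem_Icc M x.2)).map_fun T
  have hT : (fun ω i ↦ nodeSum H M (fun t ↦ W t ω) m (k i)) = fun ω ↦ T fun x ↦
      W ((4 * k x.1 + quarterNode M x.2) / 2 ^ (m + 2)) ω := by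
    ext; simp [T, nodeSum]
  exact hT ▸ h

lemma integral_nodeSum (hW : IsFBM P H W) (hH : 0 < H) (M : ℕ) {m k : ℕ} (hk : k < 2 ^ m) :
    ∫ ω, nodeSum H M (fun t ↦ W t ω) m k ∂P = 0 := by
  have hmem := fun p ↦ node_mem_Icc hk (quarterNode_mem_Icc M p)
  unfold nodeSum
  rw [integral_finsetSum _ fun p _ ↦
    (((hW.hasGaussianLaw (fun _ : Unit ↦ _) fun _ ↦ hmem p).eval ()).integrable.const_mul _)]
  exact Finset.sum_eq_zero fun p _ ↦ by
    rw [integral_const_mul, hW.integral_eq_zero hH (hmem p), mul_zero]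

lemma covariance_nodeSum [IsProbabilityMeasure P] (hW : IsFBM P H W) (hH : 0 < H) (M : ℕ)
    {m k l : ℕ} (hk : k < 2 ^ m) (hl : l < 2 ^ m) :
    cov[fun ω ↦ nodeSum H M (fun t ↦ W t ω) m k, fun ω ↦ nodeSum H M (fun t ↦ W t ω) m l; P] =
      nodeCov H M (k - l) := by
  have hmem := fun {k : ℕ} (hk : k < 2 ^ m) p ↦ node_mem_Icc hk (quarterNode_mem_Icc M p)
  unfold nodeSum
  rw [covariance_fun_sum_fun_sum (fun p ↦ (hW.memLp_two (hmem hk p)).const_mul _)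
    fun p ↦ (hW.memLp_two (hmem hl p)).const_mul _]
  simp_rw [covariance_const_mul_left, covariance_const_mul_right]
  set c : ℝ := (2 : ℝ) ^ (m * H + 1) / M with hc
  set s : Fin M × Fin 4 → ℝ := fun p ↦ (4 * k + quarterNode M p) / 2 ^ (m + 2) with hs
  set t : Fin M × Fin 4 → ℝ := fun p ↦ (4 * l + quarterNode M p) / 2 ^ (m + 2) with ht
  have hcov : ∀ p q, cov[W (s p), W (t q); P] = fbmCov H (s p) (t q) := fun p q ↦
    hW.covariance_eq hH (hmem hk p) (hmem hl q)
  have hdiff : ∀ p q, |s p - t q| ^ (2 * H) = ((2 : ℝ) ^ (((m : ℝ) + 2) * (2 * H)))⁻¹ *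
      |4 * ((k - l : ℤ) : ℝ) + (quarterNode M p - quarterNode M q)| ^ (2 * H) := fun p q ↦ by
    have : s p - t q =
        (4 * ((k - l : ℤ) : ℝ) + (quarterNode M p - quarterNode M q)) / 2 ^ (m + 2) := by
      simp only [hs, ht]; push_cast; ring
    rw [this, abs_div, Real.div_rpow (abs_nonneg _) (abs_nonneg _), div_eq_inv_mul,
      abs_of_pos (by positivity), ← Real.rpow_natCast, ← Real.rpow_mul two_pos.le]
    push_cast
    rfl
  have hsplit : ∀ p q, c * quarterSign p.2 * (c * quarterSign q.2 * fbmCov H (s p) (t q)) =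
      c ^ 2 / 2 * (quarterSign p.2 * s p ^ (2 * H)) * quarterSign q.2
      + c ^ 2 / 2 * quarterSign p.2 * (quarterSign q.2 * t q ^ (2 * H))
      - c ^ 2 / 2 * (quarterSign p.2 * quarterSign q.2 * |s p - t q| ^ (2 * H)) := fun p q ↦ by
    rw [fbmCov]; ring
  change ∑ p, ∑ q, c * quarterSign p.2 * (c * quarterSign q.2 * cov[W (s p), W (t q); P]) = _
  simp_rw [hcov, hsplit, Finset.sum_sub_distrib, Finset.sum_add_distrib, ← Finset.mul_sum,
    sum_quarterSign, mul_zero, ← Finset.sum_mul, ← Finset.mul_sum, sum_quarterSign, hdiff,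
    mul_left_comm _ ((2 : ℝ) ^ (((m : ℝ) + 2) * (2 * H)))⁻¹, ← Finset.mul_sum, nodeCov, ← mul_assoc]
  have hcoef : c ^ 2 / 2 * (2 ^ (((m : ℝ) + 2) * (2 * H)))⁻¹ = (2 : ℝ) ^ (1 - 4 * H) / M ^ 2 := by
    have e1 : ((2 : ℝ) ^ (m * H + 1)) ^ 2 =
        2 ^ (1 - 4 * H) * 2 * 2 ^ (((m : ℝ) + 2) * (2 * H)) := by
      rw [← Real.rpow_natCast, ← Real.rpow_mul two_pos.le, ← Real.rpow_add_one two_ne_zero,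
        ← Real.rpow_add two_pos]
      congr 1
      push_cast
      ring
    rw [hc, div_pow, e1]
    field_simp
  rw [mul_assoc ((m : ℝ) + 2) 2 H, hcoef]
  simp

end IsFBM

lemma block_index_lt {n i : ℕ} (hi : i < 2 ^ n) (j : Fin (2 ^ n)) :
    2 ^ n * i + j < 2 ^ (2 * n) :=
  calc 2 ^ n * i + j < 2 ^ n * i + 2 ^ n := by omega
    _ = 2 ^ n * (i + 1) := by ring
    _ ≤ 2 ^ n * 2 ^ n := Nat.mul_le_mul_left _ hi
    _ = 2 ^ (2 * n) := by ring

namespace IsFBM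

variable {Ω : Type*} [MeasurableSpace Ω] {P : Measure Ω} {H : ℝ} {W : ℝ → Ω → ℝ}

lemma ae_tendsto_nodeSum (hW : IsFBM P H W) : ∀ᵐ ω ∂P, ∀ m k, k < 2 ^ m →
    Tendsto (fun M ↦ nodeSum H M (fun t ↦ W t ω) m k) atTop
      (𝓝 (normCoeff H (fun t ↦ ∫ s in (0 : ℝ)..t, W s ω) m k)) := by
  filter_upwards [hW.2.1] with ω hω m k hk using tendsto_nodeSum H hω hk

lemma aemeasurable_normCoeff (hW : IsFBM P H W) {m k : ℕ} (hk : k < 2 ^ m) :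
    AEMeasurable (fun ω ↦ normCoeff H (fun t ↦ ∫ s in (0 : ℝ)..t, W s ω) m k) P :=
  aemeasurable_of_tendsto_metrizable_ae' (fun M ↦ (hW.measurable_nodeSum M m k).aemeasurable)
    (hW.ae_tendsto_nodeSum.mono fun _ h ↦ h m k hk)

variable [IsProbabilityMeasure P]

lemma variance_nodeSum (hW : IsFBM P H W) (hH : 0 < H) (M : ℕ) {m k : ℕ} (hk : k < 2 ^ m) :
    Var[fun ω ↦ nodeSum H M (fun t ↦ W t ω) m k; P] = nodeCov H M 0 := by
  rw [← covariance_self (hW.measurable_nodeSum M m k).aemeasurable,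
    hW.covariance_nodeSum hH M hk hk, sub_self]

lemma nodeCov_zero_nonneg (hW : IsFBM P H W) (hH : 0 < H) (M : ℕ) : 0 ≤ nodeCov H M 0 := by
  rw [← hW.variance_nodeSum hH M (m := 0) (k := 0) (by simp)]
  exact variance_nonneg _ _

lemma map_nodeSum (hW : IsFBM P H W) (hH : 0 < H) (M : ℕ) {m k : ℕ} (hk : k < 2 ^ m) :
    P.map (fun ω ↦ nodeSum H M (fun t ↦ W t ω) m k) =
      gaussianReal 0 (nodeCov H M 0).toNNReal := by
  have h := ((hW.hasGaussianLaw_nodeSum M m (k := fun _ : Fin 1 ↦ k) fun _ ↦ hk).eval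
    0).map_eq_gaussianReal
  rwa [hW.integral_nodeSum hH M hk, hW.variance_nodeSum hH M hk] at h

lemma map_normCoeff (hW : IsFBM P H W) (hH : 0 < H) {φ : ℕ → ℕ} (hφ : Tendsto φ atTop atTop)
    {τ : ℝ} (hτ : Tendsto (fun M ↦ nodeCov H (φ M) 0) atTop (𝓝 τ)) {m k : ℕ} (hk : k < 2 ^ m) :
    P.map (fun ω ↦ normCoeff H (fun t ↦ ∫ s in (0 : ℝ)..t, W s ω) m k) =
      gaussianReal 0 τ.toNNReal := by
  refine map_eq_gaussianReal_of_tendsto_ae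
    (f := fun M ω ↦ nodeSum H (φ M) (fun t ↦ W t ω) m k)
    (fun M ↦ hW.measurable_nodeSum _ m k) (fun M ↦ hW.map_nodeSum hH (φ M) hk)
    ((continuous_real_toNNReal.tendsto τ).comp hτ) ?_
  filter_upwards [hW.ae_tendsto_nodeSum] with ω hω using (hω m k hk).comp hφ

lemma exists_tendsto_nodeCov (hW : IsFBM P H W) (hH : H ∈ Set.Ioo (0 : ℝ) 1) :
    ∃ φ : ℕ → ℕ, StrictMono φ ∧ Tendsto (fun M ↦ nodeCov H (φ M) 0) atTop
      (𝓝 (∫ ω, vartheta (fun t ↦ ∫ s in (0 : ℝ)..t, W s ω) 0 0 ^ 2 ∂P)) := by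
  have hmem : ∀ M, nodeCov H M 0 ∈ Set.Icc (0 : ℝ) 147456 := fun M ↦
    ⟨hW.nodeCov_zero_nonneg hH.1 M, (le_abs_self _).trans (by simpa using abs_nodeCov_le hH M 0)⟩
  obtain ⟨τ, hτ, φ, hφ, hlim⟩ := isCompact_Icc.tendsto_subseq hmem
  refine ⟨φ, hφ, ?_⟩
  have hlaw := hW.map_normCoeff hH.1 hφ.tendsto_atTop hlim (m := 0) (k := 0) (by simp)
  simp only [normCoeff, Nat.cast_zero, zero_mul, Real.rpow_zero, one_mul] at hlaw
  have hmeas := hW.aemeasurable_normCoeff (m := 0) (k := 0) (by simp)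
  simp only [normCoeff, Nat.cast_zero, zero_mul, Real.rpow_zero, one_mul] at hmeas
  have hvar := variance_fun_id_gaussianReal (μ := 0) (v := τ.toNNReal)
  rw [← hlaw, variance_map aemeasurable_id' hmeas, Function.comp_def,
    variance_of_integral_eq_zero hmeas, Real.coe_toNNReal _ hτ.1] at hvar
  · exact hvar ▸ hlim
  · have := integral_map hmeas (f := fun x ↦ x) aestronglyMeasurable_id
    rw [← this, hlaw, integral_id_gaussianReal]

/-- Exponential bound for the fluctuations of the block energy. -/
lemma lintegral_exp_le (hW : IsFBM P H W) (hH : 0 < H) {L : ℝ}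
    (hL : ∀ M N (i : Fin N), ∑ j : Fin N, |nodeCov H M ((i : ℕ) - (j : ℕ))| ≤ L)
    {φ : ℕ → ℕ} (hφ : Tendsto φ atTop atTop)
    {τ : ℝ} (hτ : Tendsto (fun M ↦ nodeCov H (φ M) 0) atTop (𝓝 τ)) {n i : ℕ} (hi : i < 2 ^ n)
    {s : ℝ} (hs : |s| * L ≤ 1 / 4) :
    ∫⁻ ω, ENNReal.ofReal (Real.exp (s * (∑ j : Fin (2 ^ n),
        normCoeff H (fun t ↦ ∫ u in (0 : ℝ)..t, W u ω) (2 * n) (2 ^ n * i + j) ^ 2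
          - 2 ^ n * τ))) ∂P ≤
      ENNReal.ofReal (Real.exp (4 * s ^ 2 * (2 ^ n * L ^ 2))) := by
  have hk : ∀ j : Fin (2 ^ n), 2 ^ n * i + j < 2 ^ (2 * n) := block_index_lt hi
  let X : ℕ → Fin (2 ^ n) → Ω → ℝ := fun M j ω ↦
    nodeSum H (φ M) (fun t ↦ W t ω) (2 * n) (2 ^ n * i + j)
  have hXm : ∀ M j, Measurable (X M j) := fun M j ↦ hW.measurable_nodeSum _ _ _
  have hbound : ∀ M, ∫⁻ ω, ENNReal.ofReal
      (Real.exp (s * (∑ j, X M j ω ^ 2 - 2 ^ n * nodeCov H (φ M) 0))) ∂P ≤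
      ENNReal.ofReal (Real.exp (4 * s ^ 2 * (2 ^ n * L ^ 2))) := fun M ↦ by
    have := lintegral_exp_sum_sq_sub_le (hXm M)
      (hW.hasGaussianLaw_nodeSum (φ M) (2 * n) hk) (fun j ↦ hW.integral_nodeSum hH (φ M) (hk j))
      (L := L) (fun j ↦ ?_) hs
    · simp_rw [X, hW.variance_nodeSum hH (φ M) (hk _)] at this
      simpa [X] using this
    · refine le_trans (le_of_eq (Finset.sum_congr rfl fun l _ ↦ ?_)) (hL (φ M) (2 ^ n) j)
      rw [hW.covariance_nodeSum hH (φ M) (hk j) (hk l)]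
      congr 2
      push_cast
      ring
  calc _ = ∫⁻ ω, liminf (fun M ↦ ENNReal.ofReal
        (Real.exp (s * (∑ j, X M j ω ^ 2 - 2 ^ n * nodeCov H (φ M) 0)))) atTop ∂P := by
        refine lintegral_congr_ae ?_
        filter_upwards [hW.ae_tendsto_nodeSum] with ω hω
        refine (Tendsto.liminf_eq (ENNReal.tendsto_ofReal ((Real.continuous_exp.tendsto _).comp
          (((tendsto_finsetSum _ fun j _ ↦ ((hω _ _ (hk j)).comp hφ).pow 2).sub
            (hτ.const_mul _)).const_mul s)))).symm
    _ ≤ liminf (fun M ↦ ∫⁻ ω, ENNReal.ofReal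
        (Real.exp (s * (∑ j, X M j ω ^ 2 - 2 ^ n * nodeCov H (φ M) 0))) ∂P) atTop :=
        lintegral_liminf_le fun M ↦ by have := hXm M; fun_prop
    _ ≤ _ := liminf_le_of_le (by isBoundedDefault) fun b hb ↦ by
        obtain ⟨M, hM⟩ := hb.exists
        exact hM.trans (hbound M)

end IsFBM

/-- Two-sided Chernoff bound. -/
lemma measure_le_abs_le_of_lintegral_exp_le {Ω : Type*} [MeasurableSpace Ω] {P : Measure Ω}
    {S : Ω → ℝ} (hS : AEMeasurable S P) {s r B : ℝ} (hs : 0 ≤ s)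
    (h : ∀ t, |t| = s →
      ∫⁻ ω, ENNReal.ofReal (Real.exp (t * S ω)) ∂P ≤ ENNReal.ofReal (Real.exp B)) :
    P {ω | r ≤ |S ω|} ≤ ENNReal.ofReal (2 * Real.exp (B - s * r)) := by
  have key : ∀ t, |t| = s → P {ω | s * r ≤ t * S ω} ≤ ENNReal.ofReal (Real.exp (B - s * r)) :=
    fun t ht ↦ by
    have hm := mul_meas_ge_le_lintegral₀ (μ := P)
      (f := fun ω ↦ ENNReal.ofReal (Real.exp (t * S ω))) (by fun_prop)
      (ENNReal.ofReal (Real.exp (s * r)))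
    have hset : {ω | ENNReal.ofReal (Real.exp (s * r)) ≤ ENNReal.ofReal (Real.exp (t * S ω))} =
        {ω | s * r ≤ t * S ω} := by
      ext ω
      simp [ENNReal.ofReal_le_ofReal_iff (Real.exp_pos _).le]
    rw [hset] at hm
    rw [Real.exp_sub, ENNReal.ofReal_div_of_pos (Real.exp_pos _), ENNReal.le_div_iff_mul_le
      (Or.inl (by simp [Real.exp_pos])) (Or.inl ENNReal.ofReal_ne_top), mul_comm]
    exact hm.trans (h t ht)
  have hsub : {ω | r ≤ |S ω|} ⊆ {ω | s * r ≤ s * S ω} ∪ {ω | s * r ≤ -s * S ω} := fun ω hω ↦ by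
    rcases le_abs.mp (Set.mem_ofPred_eq ▸ hω) with h | h
    · exact Or.inl (mul_le_mul_of_nonneg_left h hs)
    · refine Or.inr ?_
      rw [Set.mem_ofPred_eq, neg_mul, ← mul_neg]
      exact mul_le_mul_of_nonneg_left h hs
  calc P {ω | r ≤ |S ω|} ≤ _ := (measure_mono hsub).trans (measure_union_le _ _)
    _ ≤ ENNReal.ofReal (Real.exp (B - s * r)) + ENNReal.ofReal (Real.exp (B - s * r)) :=
      add_le_add (key s (abs_of_nonneg hs)) (key (-s) (by rw [abs_neg, abs_of_nonneg hs]))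
    _ = _ := by
      rw [← ENNReal.ofReal_add (Real.exp_pos _).le (Real.exp_pos _).le, two_mul]

/-- Borel–Cantelli lemma for families of `2 ^ n` events of probability `O(4 ^ (-n))`. -/
lemma ae_eventually_forall_lt_two_pow {Ω : Type*} [MeasurableSpace Ω] {P : Measure Ω}
    {A : ℕ → ℕ → Set Ω} {C : ℝ}
    (hA : ∀ᶠ n in atTop, ∀ i < 2 ^ n, P (A n i) ≤ ENNReal.ofReal (C * (1 / 4) ^ n)) :
    ∀ᵐ ω ∂P, ∀ᶠ n in atTop, ∀ i < 2 ^ n, ω ∉ A n i := by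
  obtain ⟨n₁, hn₁⟩ := eventually_atTop.mp hA
  have hunion : ∀ n, P (⋃ i ∈ Finset.range (2 ^ (n + n₁)), A (n + n₁) i) ≤
      ENNReal.ofReal (|C| * (1 / 2) ^ n) := fun n ↦ by
    calc _ ≤ ∑ i ∈ Finset.range (2 ^ (n + n₁)), P (A (n + n₁) i) := measure_biUnion_finset_le _ _
      _ ≤ ∑ _i ∈ Finset.range (2 ^ (n + n₁)), ENNReal.ofReal (C * (1 / 4) ^ (n + n₁)) :=
        Finset.sum_le_sum fun i hi ↦ hn₁ _ (by omega) i (Finset.mem_range.mp hi)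
      _ = ENNReal.ofReal (C * (1 / 2) ^ (n + n₁)) := by
        rw [Finset.sum_const, Finset.card_range, nsmul_eq_mul, ← ENNReal.ofReal_natCast,
          ← ENNReal.ofReal_mul (Nat.cast_nonneg _)]
        congr 1
        push_cast
        rw [mul_left_comm, ← mul_pow]
        norm_num
      _ ≤ _ := by
        refine ENNReal.ofReal_le_ofReal (mul_le_mul (le_abs_self C) ?_ (by positivity)
          (abs_nonneg C))
        exact pow_le_pow_of_le_one (by norm_num) (by norm_num) (by omega)
  have hsum : ∑' n, P (⋃ i ∈ Finset.range (2 ^ (n + n₁)), A (n + n₁) i) ≠ ⊤ := by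
    refine ne_top_of_le_ne_top ?_ (ENNReal.tsum_le_tsum hunion)
    exact (summable_geometric_two.mul_left |C|).tsum_ofReal_ne_top
  filter_upwards [ae_eventually_notMem hsum] with ω hω
  rw [← map_add_atTop_eq_nat n₁, eventually_map]
  filter_upwards [hω] with n hn i hi hmem
  exact hn (Set.mem_biUnion (Finset.mem_coe.mpr (Finset.mem_range.mpr hi)) hmem)

lemma deltaSeq_eq (c : ℝ) (n : ℕ) :
    deltaSeq c n = c * √((n * Real.log 2 + 2 * Real.log n) / 2 ^ n) := by
  have h : 0 ≤ n * Real.log 2 + 2 * Real.log n :=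
    add_nonneg (by positivity) (mul_nonneg two_pos.le (Real.log_natCast_nonneg n))
  rw [deltaSeq, Real.sqrt_div h, mul_assoc, Real.sqrt_eq_rpow (2 ^ n), ← Real.rpow_natCast,
    ← Real.rpow_mul two_pos.le, neg_div, Real.rpow_neg two_pos.le, mul_one_div,
    ← div_eq_inv_mul]

lemma tendsto_sqrt_log_div_two_pow :
    Tendsto (fun n : ℕ ↦ √((n * Real.log 2 + 2 * Real.log n) / 2 ^ n)) atTop (𝓝 0) := by
  have h0 := tendsto_self_mul_const_pow_of_lt_one (r := (1 / 2 : ℝ)) (by norm_num) (by norm_num)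
  have hle : ∀ n : ℕ, (n * Real.log 2 + 2 * Real.log n) / 2 ^ n ≤ 3 * (n * (1 / 2 : ℝ) ^ n) :=
    fun n ↦ by
    have h1 : Real.log n ≤ n := Real.log_le_self n.cast_nonneg
    have h2 : n * Real.log 2 ≤ n * 1 :=
      mul_le_mul_of_nonneg_left (by linarith [Real.log_two_lt_d9]) n.cast_nonneg
    rw [div_eq_mul_inv, one_div, inv_pow, ← mul_assoc]
    gcongr
    linarith
  have h := squeeze_zero (fun n ↦ div_nonneg (add_nonneg (by positivity)
    (mul_nonneg two_pos.le (Real.log_natCast_nonneg n))) (by positivity)) hle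
    (by simpa using h0.const_mul 3)
  simpa using h.sqrt

lemma exp_neg_two_mul_le (n : ℕ) :
    Real.exp (-(2 * (n * Real.log 2 + 2 * Real.log n))) ≤ (1 / 4) ^ n := by
  have h4 : Real.log (1 / 4) = -(2 * Real.log 2) := by
    rw [one_div, Real.log_inv, show (4 : ℝ) = 2 ^ 2 by norm_num, Real.log_pow]
    norm_num
  rw [← Real.exp_log (show (0 : ℝ) < 1 / 4 by norm_num), ← Real.exp_nat_mul, h4]
  refine Real.exp_le_exp.mpr ?_
  linarith [Real.log_natCast_nonneg n]

lemma sq_mul_le_and_le_sq_mul {z τ δ : ℝ} (hτ : 0 < τ) (h0 : 0 ≤ δ) (h1 : δ ≤ 1)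
    (hz : |z - τ| < δ * τ) : (1 - δ) ^ 2 * τ ≤ z ∧ z ≤ (1 + δ) ^ 2 * τ := by
  obtain ⟨hl, hu⟩ := abs_lt.mp hz
  have h2 : 0 ≤ δ * (1 - δ) * τ := by
    have := sub_nonneg.mpr h1
    positivity
  have h3 : 0 ≤ δ * (1 + δ) * τ := by positivity
  constructor <;> nlinarith

namespace IsFBM

variable {Ω : Type*} [MeasurableSpace Ω] {P : Measure Ω} [IsProbabilityMeasure P] {H : ℝ}
  {W : ℝ → Ω → ℝ}

/-- Degenerate case of vanishing variance. -/
lemma ae_normCoeff_eq_zero (hW : IsFBM P H W) (hH : 0 < H) {φ : ℕ → ℕ} (hφ : Tendsto φ atTop atTop)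
    (hτ : Tendsto (fun M ↦ nodeCov H (φ M) 0) atTop (𝓝 0)) :
    ∀ᵐ ω ∂P, ∀ m k, k < 2 ^ m → normCoeff H (fun t ↦ ∫ s in (0 : ℝ)..t, W s ω) m k = 0 := by
  refine ae_all_iff.mpr fun m ↦ ae_all_iff.mpr fun k ↦ ?_
  by_cases hk : k < 2 ^ m
  · have hlaw := hW.map_normCoeff hH hφ hτ hk
    rw [Real.toNNReal_zero, gaussianReal_zero_var] at hlaw
    have h : ∀ᵐ x ∂(P.map fun ω ↦ normCoeff H (fun t ↦ ∫ s in (0 : ℝ)..t, W s ω) m k), x = 0 := by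
      rw [hlaw, ae_dirac_eq]
      rfl
    filter_upwards [ae_of_ae_map (hW.aemeasurable_normCoeff hk) h] with ω hω _ using hω
  · exact ae_of_all _ fun _ h ↦ (hk h).elim

lemma ae_eventually_abs_sub_lt (hW : IsFBM P H W) (hH : 0 < H) {L : ℝ}
    (hL : ∀ M N (i : Fin N), ∑ j : Fin N, |nodeCov H M ((i : ℕ) - (j : ℕ))| ≤ L)
    {φ : ℕ → ℕ} (hφ : Tendsto φ atTop atTop)
    {τ : ℝ} (hτ : Tendsto (fun M ↦ nodeCov H (φ M) 0) atTop (𝓝 τ)) (hτ0 : 0 < τ) :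
    ∀ᵐ ω ∂P, ∀ᶠ n : ℕ in atTop, ∀ i < 2 ^ n,
      |(2 : ℝ) ^ ((n : ℝ) * (4 * H - 3)) *
        blockNormSq (fun t ↦ ∫ s in (0 : ℝ)..t, W s ω) n i - τ| <
      deltaSeq ((4 * L ^ 2 + 2) / τ) n * τ := by
  let Y : Ω → ℝ → ℝ := fun ω t ↦ ∫ s in (0 : ℝ)..t, W s ω
  let S : ℕ → ℕ → Ω → ℝ := fun n i ω ↦
    ∑ j : Fin (2 ^ n), normCoeff H (Y ω) (2 * n) (2 ^ n * i + j) ^ 2 - 2 ^ n * τ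
  let r : ℕ → ℝ := fun n ↦ 2 ^ n * (deltaSeq ((4 * L ^ 2 + 2) / τ) n * τ)
  have hev : ∀ᶠ n : ℕ in atTop,
      √((n * Real.log 2 + 2 * Real.log n) / 2 ^ n) * L ≤ 1 / 4 :=
    (tendsto_sqrt_log_div_two_pow.mul_const L).eventually_le_const (by norm_num)
  have hBC := ae_eventually_forall_lt_two_pow (P := P) (C := 2)
    (A := fun n i ↦ {ω | r n ≤ |S n i ω|}) <| by
    filter_upwards [hev] with n hn i hi
    have hq : 0 ≤ n * Real.log 2 + 2 * Real.log n :=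
      add_nonneg (by positivity) (mul_nonneg two_pos.le (Real.log_natCast_nonneg n))
    set s := √((n * Real.log 2 + 2 * Real.log n) / 2 ^ n) with hs
    have hs2 : s ^ 2 * 2 ^ n = n * Real.log 2 + 2 * Real.log n := by
      rw [hs, Real.sq_sqrt (by positivity), div_mul_cancel₀ _ (by positivity)]
    have hmeas : AEMeasurable (S n i) P :=
      (Finset.aemeasurable_fun_sum _ fun j _ ↦ (hW.aemeasurable_normCoeff
        (block_index_lt hi j)).pow_const 2).sub_const _
    refine (measure_le_abs_le_of_lintegral_exp_le hmeas (Real.sqrt_nonneg _)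
      fun t ht ↦ hW.lintegral_exp_le hH hL hφ hτ hi (s := t) (by rwa [ht])
        |>.trans_eq (by rw [← sq_abs, ht])).trans (ENNReal.ofReal_le_ofReal ?_)
    refine mul_le_mul_of_nonneg_left (le_trans (le_of_eq ?_) (exp_neg_two_mul_le n)) two_pos.le
    congr 1
    simp only [r]
    rw [deltaSeq_eq, ← hs, ← hs2]
    field_simp
    ring
  filter_upwards [hBC] with ω hω
  filter_upwards [hω] with n hn i hi
  have h2 : (0 : ℝ) < 2 ^ n := by positivity
  have h := not_le.mp (hn i hi)
  rw [rpow_mul_blockNormSq, ← mul_lt_mul_iff_right₀ h2, ← abs_of_pos h2, ← abs_mul, mul_sub,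
    abs_of_pos h2, mul_div_cancel₀ _ h2.ne']
  exact h

end IsFBM

/-- Remark 2.2 (pathwise two-sided bounds): there is `c_H > 0` such that `P`-a.s. there is
`n₀` with `(1-δ_n)² τ_H ≤ 2^{n(4H-3)} ‖ϑ̄^Y_{2n,i}‖² ≤ (1+δ_n)² τ_H` for all `n ≥ n₀` and
all `0 ≤ i ≤ 2^n - 1`, where `Y_t = ∫₀ᵗ W^H_s ds`. -/
theorem stmt5 {Ω : Type*} [MeasurableSpace Ω] (P : Measure Ω) [IsProbabilityMeasure P]
    (H : ℝ) (hH : H ∈ Set.Ioo (0 : ℝ) 1)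
    (W : ℝ → Ω → ℝ) (hW : IsFBM P H W)
    (tauH : ℝ)
    (htau : tauH = ∫ ω, (vartheta (fun t => ∫ s in (0 : ℝ)..t, W s ω) 0 0) ^ 2 ∂P) :
    ∃ cH : ℝ, 0 < cH ∧ ∀ᵐ ω ∂P, ∃ n₀ : ℕ, ∀ n ≥ n₀, ∀ i < 2 ^ n,
      (1 - deltaSeq cH n) ^ 2 * tauH ≤
          (2 : ℝ) ^ ((n : ℝ) * (4 * H - 3)) *
            blockNormSq (fun t => ∫ s in (0 : ℝ)..t, W s ω) n i ∧
        (2 : ℝ) ^ ((n : ℝ) * (4 * H - 3)) *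
            blockNormSq (fun t => ∫ s in (0 : ℝ)..t, W s ω) n i ≤
          (1 + deltaSeq cH n) ^ 2 * tauH := by
  obtain ⟨L, -, hL⟩ := exists_sum_abs_nodeCov_le hH
  obtain ⟨φ, hφ, hlim⟩ := hW.exists_tendsto_nodeCov hH
  rw [← htau] at hlim
  have hnonneg : 0 ≤ tauH := htau ▸ integral_nonneg fun ω ↦ sq_nonneg _
  rcases hnonneg.eq_or_lt with rfl | hpos
  · refine ⟨1, one_pos, ?_⟩
    filter_upwards [hW.ae_normCoeff_eq_zero hH.1 hφ.tendsto_atTop hlim] with ω hω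
    refine ⟨0, fun n _ i hi ↦ ?_⟩
    have hsum : ∑ j : Fin (2 ^ n), normCoeff H (fun t ↦ ∫ s in (0 : ℝ)..t, W s ω) (2 * n)
        (2 ^ n * i + j) ^ 2 = 0 :=
      Finset.sum_eq_zero fun j _ ↦ by rw [hω _ _ (block_index_lt hi j)]; norm_num
    rw [rpow_mul_blockNormSq, hsum]
    simp
  · have hcpos : 0 < (4 * L ^ 2 + 2) / tauH := by positivity
    refine ⟨_, hcpos, ?_⟩
    have hδ : ∀ᶠ n in atTop, deltaSeq ((4 * L ^ 2 + 2) / tauH) n ≤ 1 := by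
      simp_rw [deltaSeq_eq]
      exact (tendsto_sqrt_log_div_two_pow.const_mul _).eventually_le_const (by simp)
    filter_upwards [hW.ae_eventually_abs_sub_lt hH.1 hL hφ.tendsto_atTop hlim hpos] with ω hω
    obtain ⟨n₀, hn₀⟩ := eventually_atTop.mp (hω.and hδ)
    refine ⟨n₀, fun n hn i hi ↦ sq_mul_le_and_le_sq_mul hpos ?_ (hn₀ n hn).2 ((hn₀ n hn).1 i hi)⟩
    rw [deltaSeq_eq]
    positivity
end

section
/- Let H ∈ (0,1), let g ∈ C²(ℝ), and let x : [0,1] → ℝ be continuous and α-Hölder continuous for every α < H. Set y(t) := ∫₀ᵗ x(s) ds and v(t) := ∫₀ᵗ g(x(s)) ds. Assume there are constants c_H > 0, τ_H > 0 and n₀ ∈ ℕ such that for all n ≥ n₀ and all 0 ≤ i ≤ 2^n − 1, (1 − δ_n)² τ_H ≤ 2^{n(4H−3)} ‖ϑ̄^y_{2n,i}‖²_{ℓ₂} ≤ (1 + δ_n)² τ_H, where δ_n := c_H · 2^{−n/2} √(n log 2 + 2 log n). Then there exist n_x ∈ ℕ and intermediate times τ^a_{n,i}, τ^b_{n,i}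 ∈ [2^{−n} i, 2^{−n}(i+1)] such that for all n ≥ n_x and all 0 ≤ i ≤ 2^n − 1: ( (g'(x(τ^a_{n,i})))² (1 − δ_n)² − 2^{−5Hn/4} |g'(x(τ^b_{n,i}))| ) τ_H ≤ 2^{n(4H−3)} ‖ϑ̄^v_{2n,i}‖²_{ℓ₂} ≤ ( (g'(x(τ^b_{n,i})))² (1 + δ_n)² + 2^{−5Hn/4} |g'(x(τ^b_{n,i}))| ) τ_H. -/
open MeasureTheory ProbabilityTheory Filter

lemma vartheta_congr {f₁ f₂ : ℝ → ℝ} (h : ∀ t ∈ Set.Icc (0 : ℝ) 1, f₁ t = f₂ t) {n k : ℕ}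
    (hk : k < 2 ^ n) : vartheta f₁ n k = vartheta f₂ n k := by
  have hk' : (k : ℝ) + 1 ≤ 2 ^ n := by exact_mod_cast hk
  have hmem : ∀ r : ℝ, 0 ≤ r → r ≤ 4 → (4 * (k : ℝ) + r) / 2 ^ (n + 2) ∈ Set.Icc (0 : ℝ) 1 := by
    intro r hr hr4
    refine ⟨by positivity, ?_⟩
    rw [div_le_one (by positivity), pow_add]
    linarith
  have h0 := h _ (hmem 0 le_rfl (by norm_num))
  rw [add_zero] at h0
  unfold vartheta
  rw [h0, h _ (hmem 1 (by norm_num) (by norm_num)), h _ (hmem 3 (by norm_num) (by norm_num)),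
    h _ (hmem 4 (by norm_num) (by norm_num))]

/-- The coefficient of a primitive of `φ` is controlled by the oscillation of `φ` on the
corresponding dyadic interval. -/
lemma abs_vartheta_integral_le {φ : ℝ → ℝ} (hφ : ContinuousOn φ (Set.Icc 0 1)) {n k : ℕ}
    (hk : k < 2 ^ n) {c B : ℝ}
    (hB : ∀ s ∈ Set.Icc ((k : ℝ) / 2 ^ n) (((k : ℝ) + 1) / 2 ^ n), |φ s - c| ≤ B) :
    |vartheta (fun t => ∫ s in (0 : ℝ)..t, φ s) n k| ≤
      (2 : ℝ) ^ ((3 * (n : ℝ)) / 2 + 3) * (B / 2 ^ n) := by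
  have hk' : (k : ℝ) + 1 ≤ 2 ^ n := by exact_mod_cast hk
  obtain ⟨p, hp⟩ : ∃ p : ℝ → ℝ, ∀ r, p r = (4 * (k : ℝ) + r) / 2 ^ (n + 2) := ⟨_, fun _ => rfl⟩
  have hmem : ∀ r : ℝ, 0 ≤ r → r ≤ 4 → p r ∈ Set.Icc (0 : ℝ) 1 := by
    intro r hr hr4
    rw [hp]
    refine ⟨by positivity, ?_⟩
    rw [div_le_one (by positivity), pow_add]
    linarith
  have hp0 : p 0 = (k : ℝ) / 2 ^ n := by
    rw [hp, pow_add]; field_simp; ring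
  have hp4 : p 4 = ((k : ℝ) + 1) / 2 ^ n := by
    rw [hp, pow_add]; field_simp; ring
  have hmono : ∀ r r' : ℝ, r ≤ r' → p r ≤ p r' := by
    intro r r' h
    rw [hp, hp]; gcongr
  have hint : ∀ a ∈ Set.Icc (0 : ℝ) 1, ∀ b ∈ Set.Icc (0 : ℝ) 1,
      IntervalIntegrable φ volume a b := fun a ha b hb =>
    (hφ.mono (Set.uIcc_subset_Icc ha hb)).intervalIntegrable
  have h01 : (0 : ℝ) ∈ Set.Icc (0 : ℝ) 1 := by simp
  have key : ∀ r r' : ℝ, 0 ≤ r → r ≤ r' → r' ≤ 4 →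
      |(∫ s in (0 : ℝ)..p r', φ s) - (∫ s in (0 : ℝ)..p r, φ s) - (p r' - p r) * c| ≤
        B * (p r' - p r) := by
    intro r r' hr hrr hr'
    have hi := hint _ (hmem r hr (hrr.trans hr')) _ (hmem r' (hr.trans hrr) hr')
    rw [intervalIntegral.integral_interval_sub_left
      (hint _ h01 _ (hmem r' (hr.trans hrr) hr')) (hint _ h01 _ (hmem r hr (hrr.trans hr')))]
    have h1 : (∫ s in p r..p r', φ s) - (p r' - p r) * c = ∫ s in p r..p r', (φ s - c) := by
      rw [intervalIntegral.integral_sub hi intervalIntegrable_const]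
      simp
    rw [h1, ← Real.norm_eq_abs]
    refine (intervalIntegral.norm_integral_le_of_norm_le_const (C := B) ?_).trans ?_
    · intro s hs
      rw [Set.uIoc_of_le (hmono _ _ hrr)] at hs
      apply hB
      rw [← hp0, ← hp4]
      exact ⟨(hmono _ _ hr).trans hs.1.le, hs.2.trans (hmono _ _ hr')⟩
    · rw [abs_of_nonneg (sub_nonneg.2 (hmono _ _ hrr))]
  have k1 := key 0 1 (by norm_num) (by norm_num) (by norm_num)
  have k2 := key 1 3 (by norm_num) (by norm_num) (by norm_num)
  have k3 := key 3 4 (by norm_num) (by norm_num) (by norm_num)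
  have hd : ∀ r r' : ℝ, p r' - p r = (r' - r) / 4 * (1 / 2 ^ n) := by
    intro r r'
    rw [hp, hp, pow_add]; field_simp; ring
  rw [hd] at k1 k2 k3
  unfold vartheta
  rw [abs_mul, abs_of_pos (by positivity : (0 : ℝ) < 2 ^ ((3 * (n : ℝ)) / 2 + 3))]
  gcongr
  have e0 : (4 * (k : ℝ)) / 2 ^ (n + 2) = p 0 := by rw [hp, add_zero]
  rw [e0, ← hp, ← hp, ← hp, div_eq_mul_one_div B]
  rw [abs_le] at *
  constructor <;> nlinarith

/-- First-order Taylor estimate in terms of the oscillation of the derivative. -/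
lemma abs_sub_sub_deriv_mul_le {g : ℝ → ℝ} (hg : Differentiable ℝ g) {u w B : ℝ}
    (hB : ∀ z ∈ Set.uIcc w u, |deriv g z - deriv g w| ≤ B) :
    |g u - g w - deriv g w * (u - w)| ≤ B * |u - w| := by
  have h := (convex_uIcc w u).norm_image_sub_le_of_norm_hasDerivWithin_le
    (f := fun z => g z - deriv g w * z) (f' := fun z => deriv g z - deriv g w) (C := B)
    (fun z _ => ((hg z).hasDerivAt.sub
      (by simpa using (hasDerivAt_id z).const_mul (deriv g w))).hasDerivWithinAt)
    hB Set.left_mem_uIcc Set.right_mem_uIcc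
  rw [Real.norm_eq_abs, Real.norm_eq_abs] at h
  convert h using 2
  ring

/-- The derivative of a `C²` function is Lipschitz on bounded intervals. -/
lemma exists_lipschitz_deriv {g : ℝ → ℝ} (hg : ContDiff ℝ 2 g) (R : ℝ) :
    ∃ K : ℝ, 0 ≤ K ∧ ∀ u ∈ Set.Icc (-R) R, ∀ w ∈ Set.Icc (-R) R,
      |deriv g u - deriv g w| ≤ K * |u - w| := by
  have hg1 : ContDiff ℝ 1 (deriv g) := by
    have h : ContDiff ℝ (1 + 1) g := by simpa [one_add_one_eq_two] using hg
    exact (contDiff_succ_iff_deriv.1 h).2.2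
  obtain ⟨K, hK⟩ := (isCompact_Icc (a := -R) (b := R)).exists_bound_of_continuousOn
    (hg1.continuous_deriv le_rfl).continuousOn
  refine ⟨|K|, abs_nonneg K, fun u hu w hw => ?_⟩
  exact (convex_Icc (-R) R).norm_image_sub_le_of_norm_deriv_le
    (fun z _ => hg1.differentiable one_ne_zero z)
    (fun z hz => (hK z hz).trans (le_abs_self K)) hw hu

lemma abs_sq_sub_sq_le {v y G M D F : ℝ} (hM : 0 ≤ M) (hG : |G| ≤ M) (hy : |y| ≤ D)
    (hF : |v - G * y| ≤ F) (hE : |v - G * y| ≤ 2 * M * D) :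
    |v ^ 2 - G ^ 2 * y ^ 2| ≤ F * (4 * M * D) := by
  have h1 : |G * y| ≤ M * D := by
    rw [abs_mul]; exact mul_le_mul hG hy (abs_nonneg _) hM
  have h2 : |v + G * y| ≤ 4 * M * D := by
    rw [abs_le] at *
    constructor <;> linarith
  rw [show v ^ 2 - G ^ 2 * y ^ 2 = (v - G * y) * (v + G * y) by ring, abs_mul]
  exact mul_le_mul hF h2 (abs_nonneg _) ((abs_nonneg _).trans hF)

/-- The squared coefficients of the primitives of `x` and `g ∘ x` are comparable on a dyadic
interval on which `x` has oscillation at most `ρ`. -/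
lemma abs_vartheta_comp_sq_sub_le {g x : ℝ → ℝ} (hg : ContDiff ℝ 2 g)
    (hxc : ContinuousOn x (Set.Icc 0 1)) {n k : ℕ} (hk : k < 2 ^ n) {K R M ρ : ℝ} (hK0 : 0 ≤ K)
    (hK : ∀ u ∈ Set.Icc (-R) R, ∀ w ∈ Set.Icc (-R) R, |deriv g u - deriv g w| ≤ K * |u - w|)
    (hR : ∀ s ∈ Set.Icc (0 : ℝ) 1, x s ∈ Set.Icc (-R) R)
    (hM : ∀ s ∈ Set.Icc ((k : ℝ) / 2 ^ n) (((k : ℝ) + 1) / 2 ^ n), |deriv g (x s)| ≤ M)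
    (hρ : ∀ s ∈ Set.Icc ((k : ℝ) / 2 ^ n) (((k : ℝ) + 1) / 2 ^ n),
      |x s - x ((k : ℝ) / 2 ^ n)| ≤ ρ) :
    |vartheta (fun t => ∫ s in (0 : ℝ)..t, g (x s)) n k ^ 2 -
        deriv g (x ((k : ℝ) / 2 ^ n)) ^ 2 * vartheta (fun t => ∫ s in (0 : ℝ)..t, x s) n k ^ 2| ≤
      4 * K * M * ((2 : ℝ) ^ ((3 * (n : ℝ)) / 2 + 3) / 2 ^ n) ^ 2 * ρ ^ 3 := by
  have hk' : (k : ℝ) + 1 ≤ 2 ^ n := by exact_mod_cast hk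
  set a : ℝ := (k : ℝ) / 2 ^ n with ha
  set b : ℝ := ((k : ℝ) + 1) / 2 ^ n with hb
  set G := deriv g (x a) with hG
  have hab : a ≤ b := by rw [ha, hb]; gcongr; linarith
  have haI : a ∈ Set.Icc a b := Set.left_mem_Icc.2 hab
  have hsub : Set.Icc a b ⊆ Set.Icc (0 : ℝ) 1 :=
    Set.Icc_subset_Icc (by positivity) ((div_le_one (by positivity)).2 hk')
  have hM0 : 0 ≤ M := (abs_nonneg _).trans (hM a haI)
  have hρ0 : 0 ≤ ρ := (abs_nonneg _).trans (hρ a haI)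
  have hgc : ContinuousOn (fun s => g (x s)) (Set.Icc 0 1) :=
    hg.continuous.comp_continuousOn hxc
  have hgd : Differentiable ℝ g := hg.differentiable two_ne_zero
  have hlin : vartheta (fun t => ∫ s in (0 : ℝ)..t, g (x s)) n k -
      G * vartheta (fun t => ∫ s in (0 : ℝ)..t, x s) n k =
      vartheta (fun t => ∫ s in (0 : ℝ)..t, (g (x s) - G * x s)) n k := by
    rw [vartheta_congr (f₁ := fun t => ∫ s in (0 : ℝ)..t, (g (x s) - G * x s))
      (f₂ := fun t => (∫ s in (0 : ℝ)..t, g (x s)) - G * ∫ s in (0 : ℝ)..t, x s) ?_ hk]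
    · unfold vartheta; ring
    · intro t ht
      have hs : Set.uIcc (0 : ℝ) t ⊆ Set.Icc 0 1 := Set.uIcc_subset_Icc (by simp) ht
      rw [intervalIntegral.integral_sub (hgc.mono hs).intervalIntegrable
        ((hxc.mono hs).intervalIntegrable.const_mul G), intervalIntegral.integral_const_mul]
  have hψc : ContinuousOn (fun s => g (x s) - G * x s) (Set.Icc 0 1) :=
    hgc.sub (hxc.const_smul G)
  have hvy := abs_vartheta_integral_le hxc hk hρ
  have hbd : ∀ B : ℝ, (∀ s ∈ Set.Icc a b, ∀ z ∈ Set.uIcc (x a) (x s), |deriv g z - G| ≤ B) →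
      |vartheta (fun t => ∫ s in (0 : ℝ)..t, (g (x s) - G * x s)) n k| ≤
        (2 : ℝ) ^ ((3 * (n : ℝ)) / 2 + 3) * (B * ρ / 2 ^ n) := by
    intro B hB
    have hB0 : 0 ≤ B := (abs_nonneg _).trans (hB a haI _ Set.left_mem_uIcc)
    refine abs_vartheta_integral_le hψc hk (c := g (x a) - G * x a) fun s hs => ?_
    have h := (abs_sub_sub_deriv_mul_le hgd (hB s hs)).trans
      (mul_le_mul_of_nonneg_left (hρ s hs) hB0)
    rwa [show g (x s) - G * x s - (g (x a) - G * x a) = g (x s) - g (x a) - G * (x s - x a) by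
      ring]
  have hE := hbd (2 * M) (by
    intro s hs z hz
    have hivt := intermediate_value_uIcc
      ((hxc.mono hsub).mono (Set.uIcc_subset_Icc haI hs)) hz
    obtain ⟨s', hs', rfl⟩ := hivt
    have h1 := hM s' (Set.uIcc_subset_Icc haI hs hs')
    have h2 := hM a haI
    rw [abs_le] at *
    constructor <;> linarith)
  have hF := hbd (K * ρ) (by
    intro s hs z hz
    refine (hK z (Set.uIcc_subset_Icc (hR a (hsub haI)) (hR s (hsub hs)) hz) _
      (hR a (hsub haI))).trans ?_
    gcongr
    exact (Set.abs_sub_left_of_mem_uIcc hz).trans (hρ s hs))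
  rw [← hlin] at hE hF
  refine (abs_sq_sub_sq_le hM0 (hM a haI) hvy hF (hE.trans_eq (by ring))).trans_eq ?_
  ring

/-- Lemma 2.3 (pathwise version): transfer of the two-sided block bounds from
`y(t) = ∫₀ᵗ x(s) ds` to `v(t) = ∫₀ᵗ g(x(s)) ds`, with intermediate times
`τ^a_{n,i}, τ^b_{n,i} ∈ [2^{-n} i, 2^{-n}(i+1)]`. -/
theorem stmt6 (H : ℝ) (hH : H ∈ Set.Ioo (0 : ℝ) 1)
    (g : ℝ → ℝ) (hg : ContDiff ℝ 2 g)
    (x : ℝ → ℝ) (hxc : ContinuousOn x (Set.Icc 0 1))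
    (hxHolder : ∀ a : ℝ, 0 < a → a < H → ∃ c : ℝ, 0 ≤ c ∧
      ∀ s ∈ Set.Icc (0 : ℝ) 1, ∀ t ∈ Set.Icc (0 : ℝ) 1, |x s - x t| ≤ c * |s - t| ^ a)
    (cH tauH : ℝ) (hcH : 0 < cH) (htauH : 0 < tauH) (n₀ : ℕ)
    (hy : ∀ n ≥ n₀, ∀ i < 2 ^ n,
      (1 - deltaSeq cH n) ^ 2 * tauH ≤
          (2 : ℝ) ^ ((n : ℝ) * (4 * H - 3)) *
            blockNormSq (fun t => ∫ s in (0 : ℝ)..t, x s) n i ∧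
        (2 : ℝ) ^ ((n : ℝ) * (4 * H - 3)) *
            blockNormSq (fun t => ∫ s in (0 : ℝ)..t, x s) n i ≤
          (1 + deltaSeq cH n) ^ 2 * tauH) :
    ∃ nx : ℕ, ∃ τa τb : ℕ → ℕ → ℝ, ∀ n ≥ nx, ∀ i : ℕ, i < 2 ^ n →
      τa n i ∈ Set.Icc ((2 : ℝ) ^ (-(n : ℝ)) * (i : ℝ)) ((2 : ℝ) ^ (-(n : ℝ)) * ((i : ℝ) + 1)) ∧
      τb n i ∈ Set.Icc ((2 : ℝ) ^ (-(n : ℝ)) * (i : ℝ)) ((2 : ℝ) ^ (-(n : ℝ)) * ((i : ℝ) + 1)) ∧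
      ((deriv g (x (τa n i))) ^ 2 * (1 - deltaSeq cH n) ^ 2 -
          (2 : ℝ) ^ (-(5 * H * (n : ℝ)) / 4) * |deriv g (x (τb n i))|) * tauH ≤
        (2 : ℝ) ^ ((n : ℝ) * (4 * H - 3)) *
          blockNormSq (fun t => ∫ s in (0 : ℝ)..t, g (x s)) n i ∧
      (2 : ℝ) ^ ((n : ℝ) * (4 * H - 3)) *
          blockNormSq (fun t => ∫ s in (0 : ℝ)..t, g (x s)) n i ≤
        ((deriv g (x (τb n i))) ^ 2 * (1 + deltaSeq cH n) ^ 2 +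
          (2 : ℝ) ^ (-(5 * H * (n : ℝ)) / 4) * |deriv g (x (τb n i))|) * tauH := by
  obtain ⟨hH0, hH1⟩ := hH
  obtain ⟨c, hc0, hc⟩ := hxHolder (15 / 16 * H) (by positivity) (by linarith)
  obtain ⟨R, hR⟩ := isCompact_Icc.exists_bound_of_continuousOn hxc
  have hR' : ∀ s ∈ Set.Icc (0 : ℝ) 1, x s ∈ Set.Icc (-R) R := fun s hs => abs_le.1 (hR s hs)
  obtain ⟨K, hK0, hK⟩ := exists_lipschitz_deriv hg R
  have hlim : Tendsto (fun n : ℕ => 256 * K * c ^ 3 * ((2 : ℝ) ^ (-(3 / 8 * H))) ^ n) atTop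
      (nhds (256 * K * c ^ 3 * 0)) :=
    (tendsto_pow_atTop_nhds_zero_of_lt_one (by positivity)
      (Real.rpow_lt_one_of_one_lt_of_neg one_lt_two (by linarith))).const_mul _
  rw [mul_zero] at hlim
  obtain ⟨n₁, hn₁⟩ := eventually_atTop.1 (hlim.eventually (eventually_lt_nhds htauH))
  refine ⟨max n₀ n₁, ?_⟩
  suffices h : ∀ n i : ℕ, ∃ a b : ℝ, n ≥ max n₀ n₁ → i < 2 ^ n →
      a ∈ Set.Icc ((2 : ℝ) ^ (-(n : ℝ)) * (i : ℝ)) ((2 : ℝ) ^ (-(n : ℝ)) * ((i : ℝ) + 1)) ∧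
      b ∈ Set.Icc ((2 : ℝ) ^ (-(n : ℝ)) * (i : ℝ)) ((2 : ℝ) ^ (-(n : ℝ)) * ((i : ℝ) + 1)) ∧
      ((deriv g (x a)) ^ 2 * (1 - deltaSeq cH n) ^ 2 -
          (2 : ℝ) ^ (-(5 * H * (n : ℝ)) / 4) * |deriv g (x b)|) * tauH ≤
        (2 : ℝ) ^ ((n : ℝ) * (4 * H - 3)) *
          blockNormSq (fun t => ∫ s in (0 : ℝ)..t, g (x s)) n i ∧
      (2 : ℝ) ^ ((n : ℝ) * (4 * H - 3)) *
          blockNormSq (fun t => ∫ s in (0 : ℝ)..t, g (x s)) n i ≤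
        ((deriv g (x b)) ^ 2 * (1 + deltaSeq cH n) ^ 2 +
          (2 : ℝ) ^ (-(5 * H * (n : ℝ)) / 4) * |deriv g (x b)|) * tauH by
    choose τa τb hτ using h
    exact ⟨τa, τb, fun n hn i hi => hτ n i hn hi⟩
  intro n i
  by_cases hni : n ≥ max n₀ n₁ ∧ i < 2 ^ n
  swap
  · exact ⟨0, 0, fun h1 h2 => absurd ⟨h1, h2⟩ hni⟩
  obtain ⟨hn, hi⟩ := hni
  have hi' : (i : ℝ) + 1 ≤ 2 ^ n := by exact_mod_cast hi
  have hpow : (2 : ℝ) ^ (-(n : ℝ)) = 1 / 2 ^ n := by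
    rw [Real.rpow_neg zero_le_two, Real.rpow_natCast, one_div]
  set J := Set.Icc ((2 : ℝ) ^ (-(n : ℝ)) * (i : ℝ)) ((2 : ℝ) ^ (-(n : ℝ)) * ((i : ℝ) + 1)) with hJ
  have hJne : J.Nonempty := Set.nonempty_Icc.2 (by gcongr; linarith)
  have hJsub : J ⊆ Set.Icc 0 1 := by
    refine Set.Icc_subset_Icc (by positivity) ?_
    rw [hpow, one_div_mul_eq_div]
    exact (div_le_one (by positivity)).2 hi'
  have hcont : ContinuousOn (fun s => |deriv g (x s)|) J :=
    ((hg.continuous_deriv one_le_two).comp_continuousOn (hxc.mono hJsub)).abs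
  obtain ⟨a, haJ, ha⟩ := isCompact_Icc.exists_isMinOn hJne hcont
  obtain ⟨b, hbJ, hb⟩ := isCompact_Icc.exists_isMaxOn hJne hcont
  refine ⟨a, b, fun _ _ => ⟨haJ, hbJ, ?_⟩⟩
  obtain ⟨hylow, hyup⟩ := hy n ((le_max_left _ _).trans hn) i hi
  have hτ := (hn₁ n ((le_max_right _ _).trans hn)).le
  set M := |deriv g (x b)| with hMdef
  have hM0 : 0 ≤ M := abs_nonneg _
  set Q := (2 : ℝ) ^ ((n : ℝ) * (4 * H - 3)) with hQ
  set r : ℝ := (1 / 2 ^ (2 * n)) ^ (15 / 16 * H) with hr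
  set y : ℝ → ℝ := fun t => ∫ s in (0 : ℝ)..t, x s
  set v : ℝ → ℝ := fun t => ∫ s in (0 : ℝ)..t, g (x s)
  have hterm : ∀ j ∈ Finset.range (2 ^ n),
      vartheta v (2 * n) (2 ^ n * i + j) ^ 2 ≤
        M ^ 2 * vartheta y (2 * n) (2 ^ n * i + j) ^ 2 +
          256 * K * c ^ 3 * M * (2 ^ n) ^ 2 * r ^ 3 ∧
      deriv g (x a) ^ 2 * vartheta y (2 * n) (2 ^ n * i + j) ^ 2 -
          256 * K * c ^ 3 * M * (2 ^ n) ^ 2 * r ^ 3 ≤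
        vartheta v (2 * n) (2 ^ n * i + j) ^ 2 := by
    intro j hj
    have hj' : j + 1 ≤ 2 ^ n := Finset.mem_range.1 hj
    have hjR : (j : ℝ) + 1 ≤ 2 ^ n := by exact_mod_cast hj'
    have hk : 2 ^ n * i + j < 2 ^ (2 * n) := by
      rw [two_mul, pow_add]
      nlinarith
    set k := 2 ^ n * i + j with hkdef
    have hkR : (k : ℝ) = 2 ^ n * i + j := by rw [hkdef]; push_cast; ring
    have hkJ : Set.Icc ((k : ℝ) / 2 ^ (2 * n)) (((k : ℝ) + 1) / 2 ^ (2 * n)) ⊆ J := by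
      rw [hJ, hpow, hkR, two_mul, pow_add]
      apply Set.Icc_subset_Icc
      · rw [one_div_mul_eq_div, div_le_div_iff₀ (by positivity) (by positivity)]
        have : (0 : ℝ) ≤ j * 2 ^ n := by positivity
        nlinarith
      · rw [one_div_mul_eq_div, div_le_div_iff₀ (by positivity) (by positivity)]
        have : (0 : ℝ) < 2 ^ n := by positivity
        nlinarith
    have hkI : (k : ℝ) / 2 ^ (2 * n) ∈
        Set.Icc ((k : ℝ) / 2 ^ (2 * n)) (((k : ℝ) + 1) / 2 ^ (2 * n)) :=
      Set.left_mem_Icc.2 (by gcongr; linarith)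
    have hmain := abs_vartheta_comp_sq_sub_le hg hxc hk (M := M) (ρ := c * r) hK0 hK hR'
      (fun s hs => hb (hkJ hs)) (by
        intro s hs
        refine (hc s (hJsub (hkJ hs)) _ (hJsub (hkJ hkI))).trans ?_
        rw [hr]
        gcongr
        rw [abs_of_nonneg (sub_nonneg.2 hs.1), sub_le_iff_le_add, ← add_div, add_comm 1]
        exact hs.2)
    have hscale : (2 : ℝ) ^ ((3 * ((2 * n : ℕ) : ℝ)) / 2 + 3) / 2 ^ (2 * n) = 8 * 2 ^ n := by
      rw [show (3 * ((2 * n : ℕ) : ℝ)) / 2 + 3 = ((3 * n + 3 : ℕ) : ℝ) by push_cast; ring,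
        Real.rpow_natCast, div_eq_iff (by positivity)]
      ring
    rw [hscale, show 4 * K * M * (8 * 2 ^ n) ^ 2 * (c * r) ^ 3 =
      256 * K * c ^ 3 * M * (2 ^ n) ^ 2 * r ^ 3 by ring] at hmain
    have hup : deriv g (x ((k : ℝ) / 2 ^ (2 * n))) ^ 2 ≤ M ^ 2 :=
      sq_le_sq.2 ((hb (hkJ hkI)).trans (le_abs_self _))
    have hlow : deriv g (x a) ^ 2 ≤ deriv g (x ((k : ℝ) / 2 ^ (2 * n))) ^ 2 :=
      sq_le_sq.2 (ha (hkJ hkI))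
    have hup' := mul_le_mul_of_nonneg_right hup (sq_nonneg (vartheta y (2 * n) k))
    have hlow' := mul_le_mul_of_nonneg_right hlow (sq_nonneg (vartheta y (2 * n) k))
    rw [abs_le] at hmain
    exact ⟨by linarith [hmain.2], by linarith [hmain.1]⟩
  have hsum_up := Finset.sum_le_sum fun j hj => (hterm j hj).1
  have hsum_low := Finset.sum_le_sum fun j hj => (hterm j hj).2
  rw [Finset.sum_add_distrib, ← Finset.mul_sum, Finset.sum_const, Finset.card_range,
    nsmul_eq_mul] at hsum_up
  rw [Finset.sum_sub_distrib, ← Finset.mul_sum, Finset.sum_const, Finset.card_range,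
    nsmul_eq_mul] at hsum_low
  push_cast at hsum_up hsum_low
  change blockNormSq v n i ≤ M ^ 2 * blockNormSq y n i + _ at hsum_up
  change deriv g (x a) ^ 2 * blockNormSq y n i - _ ≤ blockNormSq v n i at hsum_low
  have hexp : Q * ((2 ^ n) ^ 3 * r ^ 3) =
      (2 : ℝ) ^ (-(5 * H * (n : ℝ)) / 4) * ((2 : ℝ) ^ (-(3 / 8 * H))) ^ n := by
    have h2 : (1 / 2 ^ (2 * n) : ℝ) = (2 : ℝ) ^ (-(2 * (n : ℝ))) := by
      rw [Real.rpow_neg zero_le_two, one_div, ← Real.rpow_natCast]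
      push_cast
      rfl
    rw [hQ, hr, h2, ← Real.rpow_mul zero_le_two, ← pow_mul,
      ← Real.rpow_natCast 2 (n * 3), ← Real.rpow_natCast _ 3, ← Real.rpow_natCast _ n,
      ← Real.rpow_mul zero_le_two, ← Real.rpow_mul zero_le_two, ← Real.rpow_add two_pos,
      ← Real.rpow_add two_pos, ← Real.rpow_add two_pos]
    congr 1
    push_cast
    ring
  have herr : Q * (2 ^ n * (256 * K * c ^ 3 * M * (2 ^ n) ^ 2 * r ^ 3)) ≤
      (2 : ℝ) ^ (-(5 * H * (n : ℝ)) / 4) * M * tauH := by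
    calc Q * (2 ^ n * (256 * K * c ^ 3 * M * (2 ^ n) ^ 2 * r ^ 3))
        = 256 * K * c ^ 3 * M * (Q * ((2 ^ n) ^ 3 * r ^ 3)) := by ring
      _ = (2 : ℝ) ^ (-(5 * H * (n : ℝ)) / 4) * M *
            (256 * K * c ^ 3 * ((2 : ℝ) ^ (-(3 / 8 * H))) ^ n) := by rw [hexp]; ring
      _ ≤ _ := by gcongr
  have hQ0 : 0 ≤ Q := by positivity
  have h1 := mul_le_mul_of_nonneg_left hsum_up hQ0
  have h2 := mul_le_mul_of_nonneg_left hsum_low hQ0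
  have h3 := mul_le_mul_of_nonneg_left hyup (sq_nonneg M)
  have h4 := mul_le_mul_of_nonneg_left hylow (sq_nonneg (deriv g (x a)))
  rw [← sq_abs (deriv g (x b)), ← hMdef]
  constructor <;> linarith
end

section
/- Let H ∈ (0,1), let g ∈ C²(ℝ) be strictly monotone, and let x : [0,1] → ℝ be continuous and α-Hölder continuous for every α < H, with ∫₀¹ (g'(x(s)))² ds > 0. Assume moreover: (i) there are constants c_H > 0, τ_H > 0 and n₀ ∈ ℕ such that for all n ≥ n₀ and all 0 ≤ i ≤ 2^n − 1, (1 − δ_n)² τ_H ≤ 2^{n(4H−3)} ‖ϑ̄^y_{2n,i}‖²_{ℓ₂} ≤ (1 + δ_n)² τ_H, where y(t) := ∫₀ᵗ x(s) ds and δ_n := c_H · 2^{−n/2} √(n log 2 + 2 log n); (ii) there is n₁ ∈ ℕ such that for all n ≥ n₁ and all s, t ∈ [0,1] with |s − t| ≤ 2^{−n}, |x(s) − x(t)| ≤ 2^{−Hn} √(2 n log 2). Set v(t) := ∫₀ᵗ g(x(s)) ds. Then there exist n_x ∈ ℕ and λ_x > 0 such that for all n ≥ n_x: (1 − δ_n)²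 (1 − ε_n) τ_H ∫₀¹ (g'(x(s)))² ds ≤ 2^{n(4H−4)} ‖ϑ̄^v_{2n}‖²_{ℓ₂} ≤ (1 + δ_n)² (1 + ε_n) τ_H ∫₀¹ (g'(x(s)))² ds, where ε_n := λ_x · 2^{−nH} √n. -/
open MeasureTheory ProbabilityTheory Filter

/-- The combination of values of a primitive defining `vartheta` only sees the oscillation of the
integrand. -/
lemma abs_primitive_second_difference_le {h : ℝ → ℝ} (hh : ContinuousOn h (Set.Icc 0 1))
    {a d K M : ℝ} (ha : 0 ≤ a) (hd : 0 ≤ d) (had : a + 4 * d ≤ 1)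
    (hM : ∀ s ∈ Set.Icc a (a + 4 * d), |h s - K| ≤ M) :
    |(∫ s in (0 : ℝ)..a, h s) - 2 * (∫ s in (0 : ℝ)..(a + d), h s)
      + 2 * (∫ s in (0 : ℝ)..(a + 3 * d), h s) - ∫ s in (0 : ℝ)..(a + 4 * d), h s|
      ≤ M * (4 * d) := by
  have h_int : ∀ p q : ℝ, p ∈ Set.Icc (0 : ℝ) 1 → q ∈ Set.Icc (0 : ℝ) 1 →
      IntervalIntegrable h volume p q := fun p q hp hq =>
    (hh.mono (Set.uIcc_subset_Icc hp hq)).intervalIntegrable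
  have hdiff : ∀ p q : ℝ, a ≤ p → p ≤ q → q ≤ a + 4 * d →
      |(∫ s in (0 : ℝ)..q, h s) - (∫ s in (0 : ℝ)..p, h s) - K * (q - p)| ≤ M * (q - p) := by
    intro p q hp hpq hq
    have h0 : (0 : ℝ) ∈ Set.Icc (0 : ℝ) 1 := by simp
    have hp' : p ∈ Set.Icc (0 : ℝ) 1 := ⟨by linarith, by linarith⟩
    have hq' : q ∈ Set.Icc (0 : ℝ) 1 := ⟨by linarith, by linarith⟩
    have e1 : (∫ s in (0 : ℝ)..q, h s) - (∫ s in (0 : ℝ)..p, h s) - K * (q - p)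
        = ∫ s in p..q, (h s - K) := by
      rw [intervalIntegral.integral_interval_sub_left (h_int _ _ h0 hq') (h_int _ _ h0 hp'),
        intervalIntegral.integral_sub (h_int _ _ hp' hq') intervalIntegrable_const]
      simp [mul_comm]
    rw [e1]
    have := intervalIntegral.norm_integral_le_of_norm_le_const (a := p) (b := q) (C := M)
      (f := fun s => h s - K) (by
        intro s hs
        rw [Set.uIoc_of_le hpq] at hs
        exact hM s ⟨by linarith [hs.1], by linarith [hs.2]⟩)
    rwa [abs_of_nonneg (by linarith : 0 ≤ q - p)] at this
  have h1 := abs_le.1 (hdiff a (a + d) le_rfl (by linarith) (by linarith))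
  have h2 := abs_le.1 (hdiff (a + d) (a + 3 * d) (by linarith) (by linarith) (by linarith))
  have h3 := abs_le.1 (hdiff (a + 3 * d) (a + 4 * d) (by linarith) (by linarith) le_rfl)
  rw [abs_le]
  constructor <;> nlinarith [h1.1, h1.2, h2.1, h2.2, h3.1, h3.2]

lemma abs_vartheta_primitive_sub_le {x h : ℝ → ℝ} (hx : ContinuousOn x (Set.Icc 0 1))
    (hh : ContinuousOn h (Set.Icc 0 1)) {m k : ℕ} (hk : k < 2 ^ m) {c K M : ℝ}
    (hM : ∀ s ∈ Set.Icc ((k : ℝ) / 2 ^ m) ((k + 1 : ℝ) / 2 ^ m), |h s - c * x s - K| ≤ M) :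
    |vartheta (fun t => ∫ s in (0 : ℝ)..t, h s) m k
      - c * vartheta (fun t => ∫ s in (0 : ℝ)..t, x s) m k|
      ≤ (2 : ℝ) ^ ((3 * (m : ℝ)) / 2 + 3) * (M * (1 / 2 ^ m)) := by
  have hP : (0 : ℝ) < 2 ^ m := by positivity
  have hk1 : (k : ℝ) + 1 ≤ 2 ^ m := by exact_mod_cast hk
  have h_int : ∀ f : ℝ → ℝ, ContinuousOn f (Set.Icc 0 1) → ∀ q ∈ Set.Icc (0 : ℝ) 1,
      IntervalIntegrable f volume 0 q := fun f hf q hq =>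
    (hf.mono (Set.uIcc_subset_Icc (by simp) hq)).intervalIntegrable
  have hlin : ∀ q ∈ Set.Icc (0 : ℝ) 1, ∫ s in (0 : ℝ)..q, (h s - c * x s)
      = (∫ s in (0 : ℝ)..q, h s) - c * ∫ s in (0 : ℝ)..q, x s := fun q hq => by
    rw [intervalIntegral.integral_sub (h_int h hh q hq) ((h_int x hx q hq).const_mul c),
      intervalIntegral.integral_const_mul]
  set d : ℝ := 1 / 2 ^ (m + 2) with hd
  set a : ℝ := (k : ℝ) / 2 ^ m with ha
  have hd4 : 4 * d = 1 / 2 ^ m := by rw [hd, pow_add]; field_simp; norm_num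
  have hdpos : 0 < d := by positivity
  have ha0 : 0 ≤ a := by positivity
  have had : a + 4 * d = (k + 1 : ℝ) / 2 ^ m := by rw [hd4, ha]; ring
  have had1 : a + 4 * d ≤ 1 := by rw [had, div_le_one hP]; exact hk1
  have p0 : (4 * k : ℝ) / 2 ^ (m + 2) = a := by rw [ha, pow_add]; field_simp; ring
  have pt : ∀ r : ℝ, (4 * k + r : ℝ) / 2 ^ (m + 2) = a + r * d := by
    intro r; rw [add_div, p0, hd]; ring
  have key := abs_primitive_second_difference_le (h := fun s => h s - c * x s)
    (hh.sub (continuousOn_const.mul hx)) ha0 hdpos.le had1 (K := K) (M := M)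
    (by rw [had]; exact hM)
  rw [hlin a ⟨ha0, by linarith⟩, hlin (a + d) ⟨by linarith, by linarith⟩,
    hlin (a + 3 * d) ⟨by linarith, by linarith⟩, hlin (a + 4 * d) ⟨by linarith, had1⟩, hd4] at key
  unfold vartheta
  rw [p0, pt, pt, pt, one_mul, ← hd4]
  rw [← hd4] at key
  have hpow : (0 : ℝ) < (2 : ℝ) ^ ((3 * (m : ℝ)) / 2 + 3) := by positivity
  refine le_trans (le_of_eq ?_) (mul_le_mul_of_nonneg_left key hpow.le)
  rw [← abs_of_pos hpow, ← abs_mul, abs_of_pos hpow]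
  congr 1
  ring

/-- First- and second-order estimates for a `C²` function on a bounded set. -/
lemma exists_taylor_const {g : ℝ → ℝ} (hg : ContDiff ℝ 2 g) (R : ℝ) :
    ∃ L : ℝ, 0 < L ∧ ∀ u ∈ Set.Icc (-R) R, ∀ w ∈ Set.Icc (-R) R,
      |g u - g w - deriv g w * (u - w)| ≤ L * (u - w) ^ 2 ∧
      |deriv g u ^ 2 - deriv g w ^ 2| ≤ L * |u - w| := by
  have hg' : ContDiff ℝ 1 (deriv g) := ((contDiff_succ_iff_deriv (n := 1)).1 hg).2.2
  have hgd : Differentiable ℝ g := hg.differentiable (by norm_num)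
  have hg'd : Differentiable ℝ (deriv g) := hg'.differentiable (by norm_num)
  obtain ⟨A, hA⟩ := (isCompact_Icc (a := -R) (b := R)).exists_bound_of_continuousOn
    hg'.continuous.continuousOn
  obtain ⟨B, hB⟩ := (isCompact_Icc (a := -R) (b := R)).exists_bound_of_continuousOn
    (hg'.continuous_deriv le_rfl).continuousOn
  have hlip : ∀ u ∈ Set.Icc (-R) R, ∀ w ∈ Set.Icc (-R) R,
      |deriv g u - deriv g w| ≤ |B| * |u - w| := fun u hu w hw =>
    (convex_Icc (-R) R).norm_image_sub_le_of_norm_deriv_le (fun t _ => hg'd t)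
      (fun t ht => (hB t ht).trans (le_abs_self B)) hw hu
  refine ⟨|B| + 2 * |A| * |B| + 1, by positivity, fun u hu w hw => ⟨?_, ?_⟩⟩
  · have hsub : Set.uIcc w u ⊆ Set.Icc (-R) R := Set.uIcc_subset_Icc hw hu
    have := (convex_uIcc w u).norm_image_sub_le_of_norm_deriv_le
      (f := fun t => g t - deriv g w * t) (C := |B| * |u - w|) (x := w) (y := u)
      (fun t _ => by fun_prop)
      (fun t ht => by
        have e : deriv (fun t => g t - deriv g w * t) t = deriv g t - deriv g w := by
          rw [deriv_fun_sub (hgd t) (by fun_prop)]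
          simp
        rw [e, Real.norm_eq_abs]
        refine (hlip t (hsub ht) w hw).trans ?_
        exact mul_le_mul_of_nonneg_left (Set.abs_sub_left_of_mem_uIcc ht) (abs_nonneg B))
      Set.left_mem_uIcc Set.right_mem_uIcc
    simp only [Real.norm_eq_abs] at this
    rw [mul_assoc, abs_mul_abs_self, ← sq] at this
    have e : g u - g w - deriv g w * (u - w)
        = g u - deriv g w * u - (g w - deriv g w * w) := by ring
    rw [e]
    refine this.trans ?_
    gcongr
    have : 0 ≤ |A| * |B| := by positivity
    linarith
  · have h1 := hlip u hu w hw
    have hAu : |deriv g u| ≤ |A| := (hA u hu).trans (le_abs_self A)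
    have hAw : |deriv g w| ≤ |A| := (hA w hw).trans (le_abs_self A)
    have h2 : |deriv g u + deriv g w| ≤ 2 * |A| := by
      linarith [abs_add_le (deriv g u) (deriv g w)]
    calc |deriv g u ^ 2 - deriv g w ^ 2|
        = |deriv g u + deriv g w| * |deriv g u - deriv g w| := by rw [← abs_mul]; ring_nf
      _ ≤ 2 * |A| * (|B| * |u - w|) := by gcongr
      _ ≤ _ := by nlinarith [abs_nonneg (u - w), abs_nonneg B, abs_nonneg A,
                    mul_nonneg (abs_nonneg B) (abs_nonneg (u - w))]

lemma sum_range_mul_eq (f : ℕ → ℝ) (a b : ℕ) :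
    ∑ k ∈ Finset.range (a * b), f k
      = ∑ i ∈ Finset.range b, ∑ j ∈ Finset.range a, f (a * i + j) := by
  induction b with
  | zero => simp
  | succ b ih => rw [Nat.mul_succ, Finset.sum_range_add, ih, Finset.sum_range_succ]

lemma tendsto_two_rpow_mul_sqrt {a : ℝ} (ha : 0 < a) :
    Tendsto (fun n : ℕ => (2 : ℝ) ^ (-(n : ℝ) * a) * Real.sqrt n) atTop (nhds 0) := by
  have h := tendsto_self_mul_const_pow_of_lt_one (r := (2 : ℝ) ^ (-(2 * a))) (by positivity)
    (Real.rpow_lt_one_of_one_lt_of_neg (by norm_num) (by linarith))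
  have h2 := (Real.continuous_sqrt.tendsto 0).comp h
  rw [Real.sqrt_zero] at h2
  refine h2.congr fun n => ?_
  have e : (n : ℝ) * ((2 : ℝ) ^ (-(2 * a))) ^ n = ((2 : ℝ) ^ (-(n : ℝ) * a)) ^ 2 * n := by
    rw [← Real.rpow_natCast, ← Real.rpow_natCast, ← Real.rpow_mul (by norm_num),
      ← Real.rpow_mul (by norm_num), mul_comm]
    congr 2
    push_cast
    ring
  simp only [Function.comp_apply]
  rw [e, Real.sqrt_mul (by positivity), Real.sqrt_sq (by positivity)]

lemma deltaSeq_nonneg {c : ℝ} (hc : 0 ≤ c) (n : ℕ) : 0 ≤ deltaSeq c n := by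
  unfold deltaSeq; positivity

lemma tendsto_deltaSeq {c : ℝ} (hc : 0 ≤ c) : Tendsto (deltaSeq c) atTop (nhds 0) := by
  have h := (tendsto_two_rpow_mul_sqrt (a := 1 / 2) (by norm_num)).const_mul (2 * c)
  rw [mul_zero] at h
  refine squeeze_zero (deltaSeq_nonneg hc) (fun n => ?_) h
  have h1 : Real.sqrt ((n : ℝ) * Real.log 2 + 2 * Real.log n) ≤ 2 * Real.sqrt n := by
    rw [Real.sqrt_le_left (by positivity), mul_pow, Real.sq_sqrt (by positivity)]
    have := Real.log_le_self (Nat.cast_nonneg (α := ℝ) n)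
    have := Real.log_two_lt_d9
    nlinarith [Nat.cast_nonneg (α := ℝ) n]
  unfold deltaSeq
  rw [show -(n : ℝ) / 2 = -(n : ℝ) * (1 / 2) by ring]
  calc _ ≤ c * (2 : ℝ) ^ (-(n : ℝ) * (1 / 2)) * (2 * Real.sqrt n) := by gcongr
    _ = _ := by ring

/-- The mean over an interval is close to each value of a function of small oscillation. -/
lemma abs_mul_sub_integral_le {q : ℝ → ℝ} {a b t M : ℝ} (hab : a ≤ b)
    (hq : ContinuousOn q (Set.Icc a b)) (hM : ∀ s ∈ Set.Icc a b, |q s - q t| ≤ M) :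
    |(∫ s in a..b, q s) - (b - a) * q t| ≤ (b - a) * M := by
  have e : (∫ s in a..b, q s) - (b - a) * q t = ∫ s in a..b, (q s - q t) := by
    rw [intervalIntegral.integral_sub _ intervalIntegrable_const]
    · simp
    · exact (by rwa [Set.uIcc_of_le hab] : ContinuousOn q (Set.uIcc a b)).intervalIntegrable
  rw [e]
  have := intervalIntegral.norm_integral_le_of_norm_le_const (a := a) (b := b) (C := M)
      (f := fun s => q s - q t) (by
        intro s hs
        rw [Set.uIoc_of_le hab] at hs
        exact hM s ⟨hs.1.le, hs.2⟩)
  rw [abs_of_nonneg (by linarith : 0 ≤ b - a)] at this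
  rw [mul_comm]
  exact this

/-- Perturbation of a sum of squares by an error of size `E`. -/
lemma sum_sq_perturb {s : Finset ℕ} {u v : ℕ → ℝ} {E e : ℝ} (he : 0 < e) (he1 : e ≤ 1)
    (h : ∀ k ∈ s, |u k - v k| ≤ E) :
    (1 - e) * ∑ k ∈ s, v k ^ 2 - s.card * E ^ 2 / e ≤ ∑ k ∈ s, u k ^ 2 ∧
    ∑ k ∈ s, u k ^ 2 ≤ (1 + e) * ∑ k ∈ s, v k ^ 2 + 2 * (s.card * E ^ 2 / e) := by
  have hc : (s.card : ℝ) * E ^ 2 / e = ∑ k ∈ s, E ^ 2 / e := by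
    rw [Finset.sum_const, nsmul_eq_mul]; ring
  have hE : ∀ k ∈ s, (u k - v k) ^ 2 ≤ E ^ 2 := fun k hk =>
    sq_le_sq' (abs_le.1 (h k hk)).1 (abs_le.1 (h k hk)).2
  rw [hc, Finset.mul_sum, Finset.mul_sum, Finset.mul_sum, ← Finset.sum_sub_distrib,
    ← Finset.sum_add_distrib]
  constructor <;> refine Finset.sum_le_sum fun k hk => ?_
  · have h1 : (u k - v k) ^ 2 / e ≤ E ^ 2 / e :=
      div_le_div_of_nonneg_right (hE k hk) he.le
    have h2 : 0 ≤ (e * v k + (u k - v k)) ^ 2 / e := by positivity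
    have h3 : (e * v k + (u k - v k)) ^ 2 / e
        = e * v k ^ 2 + 2 * v k * (u k - v k) + (u k - v k) ^ 2 / e := by field_simp; ring
    nlinarith [sq_nonneg (u k - v k)]
  · have h1 : (u k - v k) ^ 2 / e ≤ E ^ 2 / e :=
      div_le_div_of_nonneg_right (hE k hk) he.le
    have h2 : 0 ≤ (e * v k - (u k - v k)) ^ 2 / e := by positivity
    have h3 : (e * v k - (u k - v k)) ^ 2 / e
        = e * v k ^ 2 - 2 * v k * (u k - v k) + (u k - v k) ^ 2 / e := by field_simp; ring
    have h4 : (u k - v k) ^ 2 ≤ (u k - v k) ^ 2 / e := by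
      rw [le_div_iff₀ he]; nlinarith [sq_nonneg (u k - v k)]
    nlinarith

/-- Weighted sums of blocks, when the weights oscillate little around block means `S i` and the
blocks are nearly equal. -/
lemma weighted_blocks_bound {m : ℕ} {q y : ℕ → ℕ → ℝ} {W : ℕ → ℝ} {η lo hi c : ℝ}
    (hc : 0 ≤ c) (hη : 0 ≤ η) (hW : ∀ i < m, 0 ≤ W i)
    (hq : ∀ i < m, ∀ j < m, |q i j - W i| ≤ η)
    (hlo : ∀ i < m, lo ≤ c * ∑ j ∈ Finset.range m, y i j ^ 2)
    (hhi : ∀ i < m, c * ∑ j ∈ Finset.range m, y i j ^ 2 ≤ hi) :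
    lo * ∑ i ∈ Finset.range m, W i - m * (η * hi)
      ≤ c * ∑ i ∈ Finset.range m, ∑ j ∈ Finset.range m, q i j * y i j ^ 2 ∧
    c * ∑ i ∈ Finset.range m, ∑ j ∈ Finset.range m, q i j * y i j ^ 2
      ≤ hi * ∑ i ∈ Finset.range m, W i + m * (η * hi) := by
  have hm : (m : ℝ) * (η * hi) = ∑ i ∈ Finset.range m, η * hi := by simp
  rw [hm, Finset.mul_sum, Finset.mul_sum, Finset.mul_sum, ← Finset.sum_sub_distrib,
    ← Finset.sum_add_distrib]
  constructor <;> refine Finset.sum_le_sum fun i hi' => ?_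
  · have him := Finset.mem_range.1 hi'
    have h1 : (W i - η) * ∑ j ∈ Finset.range m, y i j ^ 2
        ≤ ∑ j ∈ Finset.range m, q i j * y i j ^ 2 := by
      rw [Finset.mul_sum]
      refine Finset.sum_le_sum fun j hj => ?_
      have := abs_le.1 (hq i him j (Finset.mem_range.1 hj))
      exact mul_le_mul_of_nonneg_right (by linarith) (sq_nonneg _)
    nlinarith [mul_le_mul_of_nonneg_left h1 hc, mul_le_mul_of_nonneg_left (hlo i him) (hW i him),
      mul_le_mul_of_nonneg_left (hhi i him) hη]
  · have him := Finset.mem_range.1 hi'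
    have h1 : ∑ j ∈ Finset.range m, q i j * y i j ^ 2
        ≤ (W i + η) * ∑ j ∈ Finset.range m, y i j ^ 2 := by
      rw [Finset.mul_sum]
      refine Finset.sum_le_sum fun j hj => ?_
      have := abs_le.1 (hq i him j (Finset.mem_range.1 hj))
      exact mul_le_mul_of_nonneg_right (by linarith) (sq_nonneg _)
    nlinarith [mul_le_mul_of_nonneg_left h1 hc, mul_le_mul_of_nonneg_left (hhi i him) (hW i him),
      mul_le_mul_of_nonneg_left (hhi i him) hη]

/-- Absorbs additive errors of order `e` into multiplicative ones. -/
lemma multiplicative_bounds_of_additive {e δ τ I L P A : ℝ} (he : 0 < e) (he1 : e ≤ 1)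
    (hδ : 0 ≤ δ) (hδ1 : δ ≤ 1 / 2) (hτ : 0 < τ) (hI : 0 < I) (hL : 0 < L)
    (hPlo : (1 - δ) ^ 2 * τ * I - 2 * L * e * ((1 + δ) ^ 2 * τ) ≤ P)
    (hPhi : P ≤ (1 + δ) ^ 2 * τ * I + 2 * L * e * ((1 + δ) ^ 2 * τ))
    (hAlo : (1 - e) * P - 1024 * L ^ 2 * e ^ 3 ≤ A)
    (hAhi : A ≤ (1 + e) * P + 2 * (1024 * L ^ 2 * e ^ 3)) :
    (1 - δ) ^ 2 * (1 - (I + 18 * L + 4096 * L ^ 2 / τ) / I * e) * (τ * I) ≤ A ∧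
      A ≤ (1 + δ) ^ 2 * (1 + (I + 18 * L + 4096 * L ^ 2 / τ) / I * e) * (τ * I) := by
  have he3 : 1024 * L ^ 2 * e ^ 3 ≤ 1024 * L ^ 2 * e := by
    have : e ^ 3 ≤ e := by simpa using pow_le_pow_of_le_one he.le he1 (show 1 ≤ 3 by norm_num)
    gcongr
  have hLe : 0 < L * e := by positivity
  have hLLe : 0 < L ^ 2 * e := by positivity
  have eq1 : (1 - δ) ^ 2 * (1 - (I + 18 * L + 4096 * L ^ 2 / τ) / I * e) * (τ * I)
      = (1 - δ) ^ 2 * (τ * (I - I * e - 18 * (L * e)) - 4096 * (L ^ 2 * e)) := by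
    field_simp; ring
  have eq2 : (1 + δ) ^ 2 * (1 + (I + 18 * L + 4096 * L ^ 2 / τ) / I * e) * (τ * I)
      = (1 + δ) ^ 2 * (τ * (I + I * e + 18 * (L * e)) + 4096 * (L ^ 2 * e)) := by
    field_simp; ring
  have hlo : 1 / 4 ≤ (1 - δ) ^ 2 := by nlinarith
  have hhi : 1 ≤ (1 + δ) ^ 2 := by nlinarith
  have hhl : (1 + δ) ^ 2 ≤ 9 * (1 - δ) ^ 2 := by nlinarith
  rw [eq1, eq2]
  generalize (1 - δ) ^ 2 = lo at *
  generalize (1 + δ) ^ 2 = hi at *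
  have hlo0 : 0 < lo := by linarith
  have hhi0 : 0 < hi := by linarith
  constructor
  · have h1 : lo * τ * (I - 18 * (L * e)) ≤ P := by
      have : 0 ≤ (9 * lo - hi) * (L * e * τ) := mul_nonneg (by linarith) (by positivity)
      nlinarith
    have h2 : (1 - e) * (lo * τ * (I - 18 * (L * e))) ≤ (1 - e) * P :=
      mul_le_mul_of_nonneg_left h1 (by linarith)
    have h3 : 0 ≤ e * (lo * τ * (18 * (L * e))) := by positivity
    have h4 : 1024 * (L ^ 2 * e) ≤ lo * (4096 * (L ^ 2 * e)) := by nlinarith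
    nlinarith
  · have h2 : (1 + e) * P ≤ (1 + e) * (hi * τ * (I + 2 * (L * e))) :=
      mul_le_mul_of_nonneg_left (by linarith) (by linarith)
    have h3 : e * (hi * τ * (2 * (L * e))) ≤ 1 * (hi * τ * (2 * (L * e))) :=
      mul_le_mul_of_nonneg_right he1 (by positivity)
    have h4 : 2048 * (L ^ 2 * e) ≤ hi * (4096 * (L ^ 2 * e)) := by nlinarith
    have h5 : 0 ≤ hi * τ * (L * e) := by positivity
    nlinarith

/-- The scaling identity behind the size of the second-order Taylor error. -/
lemma scaled_error_eq {H L : ℝ} {n : ℕ} (hn : 1 ≤ n) :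
    (2 : ℝ) ^ ((n : ℝ) * (4 * H - 4)) * (((2 ^ (2 * n) : ℕ) : ℝ) *
      ((2 : ℝ) ^ ((3 * ((2 * n : ℕ) : ℝ)) / 2 + 3) *
        (L * (2 * ((2 : ℝ) ^ (-(n : ℝ) * H)) ^ 2 * Real.sqrt n) ^ 2 * (1 / 2 ^ (2 * n)))) ^ 2 /
      ((2 : ℝ) ^ (-(n : ℝ) * H) * Real.sqrt n))
      = 1024 * L ^ 2 * ((2 : ℝ) ^ (-(n : ℝ) * H) * Real.sqrt n) ^ 3 := by
  have h2 : (0 : ℝ) < 2 := by norm_num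
  have hs : 0 < Real.sqrt n := Real.sqrt_pos.2 (by exact_mod_cast hn)
  set w := (2 : ℝ) ^ (-(n : ℝ) * H) with hw
  have hw0 : 0 < w := by positivity
  have hQ : (0 : ℝ) < 2 ^ n := by positivity
  have e1 : (2 : ℝ) ^ ((n : ℝ) * (4 * H - 4)) = (w ^ 4 * (2 ^ n) ^ 4)⁻¹ := by
    rw [hw, ← Real.rpow_natCast, ← Real.rpow_natCast, ← Real.rpow_natCast,
      ← Real.rpow_mul h2.le, ← Real.rpow_mul h2.le, ← Real.rpow_add h2, ← Real.rpow_neg h2.le]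
    congr 1; push_cast; ring
  have e2 : (2 : ℝ) ^ ((3 * ((2 * n : ℕ) : ℝ)) / 2 + 3) = 8 * (2 ^ n) ^ 3 := by
    rw [Real.rpow_add h2, ← Real.rpow_natCast 2 n, ← Real.rpow_natCast _ 3,
      ← Real.rpow_mul h2.le, mul_comm]
    congr 1
    · norm_num
    · congr 1; push_cast; ring
  have e3 : (2 : ℝ) ^ (2 * n) = (2 ^ n) ^ 2 := by rw [mul_comm, pow_mul]
  push_cast
  push_cast at e2
  rw [e1, e2, e3]
  field_simp
  ring

/-- Lemma 2.5 (pathwise version): two-sided bounds for `2^{n(4H-4)} ‖ϑ̄^v_{2n}‖²`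
with `v(t) = ∫₀ᵗ g(x(s)) ds`, given the block bounds for `y(t) = ∫₀ᵗ x(s) ds`
and the modulus of continuity of `x`. -/
theorem stmt7 (H : ℝ) (hH : H ∈ Set.Ioo (0 : ℝ) 1)
    (g : ℝ → ℝ) (hg : ContDiff ℝ 2 g) (hgm : StrictMono g ∨ StrictAnti g)
    (x : ℝ → ℝ) (hxc : ContinuousOn x (Set.Icc 0 1))
    (hxHolder : ∀ a : ℝ, 0 < a → a < H → ∃ c : ℝ, 0 ≤ c ∧
      ∀ s ∈ Set.Icc (0 : ℝ) 1, ∀ t ∈ Set.Icc (0 : ℝ) 1, |x s - x t| ≤ c * |s - t| ^ a)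
    (hpos : 0 < ∫ s in (0 : ℝ)..1, (deriv g (x s)) ^ 2)
    (cH tauH : ℝ) (hcH : 0 < cH) (htauH : 0 < tauH) (n₀ : ℕ)
    (hy : ∀ n ≥ n₀, ∀ i < 2 ^ n,
      (1 - deltaSeq cH n) ^ 2 * tauH ≤
          (2 : ℝ) ^ ((n : ℝ) * (4 * H - 3)) *
            blockNormSq (fun t => ∫ s in (0 : ℝ)..t, x s) n i ∧
        (2 : ℝ) ^ ((n : ℝ) * (4 * H - 3)) *
            blockNormSq (fun t => ∫ s in (0 : ℝ)..t, x s) n i ≤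
          (1 + deltaSeq cH n) ^ 2 * tauH)
    (n₁ : ℕ)
    (hmod : ∀ n ≥ n₁, ∀ s ∈ Set.Icc (0 : ℝ) 1, ∀ t ∈ Set.Icc (0 : ℝ) 1,
      |s - t| ≤ (2 : ℝ) ^ (-(n : ℝ)) →
        |x s - x t| ≤ (2 : ℝ) ^ (-H * (n : ℝ)) * Real.sqrt (2 * (n : ℝ) * Real.log 2)) :
    ∃ nx : ℕ, ∃ lx : ℝ, 0 < lx ∧ ∀ n ≥ nx,
      (1 - deltaSeq cH n) ^ 2 * (1 - lx * (2 : ℝ) ^ (-(n : ℝ) * H) * Real.sqrt n) *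
          (tauH * ∫ s in (0 : ℝ)..1, (deriv g (x s)) ^ 2) ≤
        (2 : ℝ) ^ ((n : ℝ) * (4 * H - 4)) *
          ∑ k ∈ Finset.range (2 ^ (2 * n)),
            (vartheta (fun t => ∫ s in (0 : ℝ)..t, g (x s)) (2 * n) k) ^ 2 ∧
      (2 : ℝ) ^ ((n : ℝ) * (4 * H - 4)) *
          ∑ k ∈ Finset.range (2 ^ (2 * n)),
            (vartheta (fun t => ∫ s in (0 : ℝ)..t, g (x s)) (2 * n) k) ^ 2 ≤
        (1 + deltaSeq cH n) ^ 2 * (1 + lx * (2 : ℝ) ^ (-(n : ℝ) * H) * Real.sqrt n) *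
          (tauH * ∫ s in (0 : ℝ)..1, (deriv g (x s)) ^ 2) := by
  obtain ⟨R, hR⟩ := (isCompact_Icc (a := (0 : ℝ)) (b := 1)).exists_bound_of_continuousOn hxc
  have hxR : ∀ s ∈ Set.Icc (0 : ℝ) 1, x s ∈ Set.Icc (-R) R := fun s hs => abs_le.1 (hR s hs)
  obtain ⟨L, hL, hT⟩ := exists_taylor_const hg R
  set I := ∫ s in (0 : ℝ)..1, (deriv g (x s)) ^ 2 with hI
  have hgc : ContinuousOn (fun s => g (x s)) (Set.Icc 0 1) := hg.continuous.comp_continuousOn hxc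
  have hqc : ContinuousOn (fun s => deriv g (x s) ^ 2) (Set.Icc 0 1) :=
    ((hg.continuous_deriv (by norm_num)).comp_continuousOn hxc).pow 2
  have hmod' : ∀ n ≥ n₁, ∀ s ∈ Set.Icc (0 : ℝ) 1, ∀ t ∈ Set.Icc (0 : ℝ) 1,
      |s - t| ≤ 1 / 2 ^ n → |x s - x t| ≤ 2 * ((2 : ℝ) ^ (-(n : ℝ) * H) * Real.sqrt n) := by
    intro n hn s hs t ht hst
    refine (hmod n hn s hs t ht ?_).trans ?_
    · rwa [Real.rpow_neg (by norm_num), Real.rpow_natCast, ← one_div]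
    · rw [show -H * (n : ℝ) = -(n : ℝ) * H by ring, mul_left_comm]
      gcongr
      rw [Real.sqrt_le_left (by positivity), mul_pow, Real.sq_sqrt (by positivity)]
      nlinarith [Real.log_two_lt_d9, Nat.cast_nonneg (α := ℝ) n]
  obtain ⟨N, hN⟩ := eventually_atTop.1
    (((tendsto_two_rpow_mul_sqrt hH.1).eventually_le_const (show (0 : ℝ) < 1 by norm_num)).and
      ((tendsto_deltaSeq hcH.le).eventually_le_const (show (0 : ℝ) < 1 / 2 by norm_num)))
  refine ⟨N + n₀ + n₁ + 1, (I + 18 * L + 4096 * L ^ 2 / tauH) / I, by positivity, fun n hn => ?_⟩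
  obtain ⟨he1, hδ1⟩ := hN n (by omega)
  have hn1 : 1 ≤ n := by omega
  have he : 0 < (2 : ℝ) ^ (-(n : ℝ) * H) * Real.sqrt n :=
    mul_pos (by positivity) (Real.sqrt_pos.2 (by exact_mod_cast hn1))
  have hscale := scaled_error_eq (H := H) (L := L) hn1
  set w := (2 : ℝ) ^ (-(n : ℝ) * H) with hw
  set e := w * Real.sqrt n with hedef
  set y := fun t => ∫ s in (0 : ℝ)..t, x s with hydef
  set v := fun t => ∫ s in (0 : ℝ)..t, g (x s) with hvdef
  set c : ℕ → ℝ := fun k => deriv g (x ((k : ℝ) / 2 ^ (2 * n))) with hc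
  have hQ : (0 : ℝ) < 2 ^ n := by positivity
  have hQ2 : (2 : ℝ) ^ (2 * n) = 2 ^ n * 2 ^ n := by rw [two_mul, pow_add]
  have htk : ∀ k : ℕ, k < 2 ^ (2 * n) → (k : ℝ) / 2 ^ (2 * n) ∈ Set.Icc (0 : ℝ) 1 := fun k hk =>
    ⟨by positivity, by rw [div_le_one (by positivity)]; exact_mod_cast hk.le⟩
  -- the coefficients of `v` are those of `y` times the local derivative, up to a quadratic error
  have hpert : ∀ k ∈ Finset.range (2 ^ (2 * n)),
      |vartheta v (2 * n) k - c k * vartheta y (2 * n) k|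
      ≤ (2 : ℝ) ^ ((3 * ((2 * n : ℕ) : ℝ)) / 2 + 3) *
        (L * (2 * w ^ 2 * Real.sqrt n) ^ 2 * (1 / 2 ^ (2 * n))) := by
    intro k hk
    have hk' := Finset.mem_range.1 hk
    have hk1 : (k : ℝ) + 1 ≤ 2 ^ (2 * n) := by exact_mod_cast hk'
    refine abs_vartheta_primitive_sub_le hxc hgc hk'
      (K := g (x ((k : ℝ) / 2 ^ (2 * n))) - c k * x ((k : ℝ) / 2 ^ (2 * n))) fun s hs => ?_
    have hs' : s ∈ Set.Icc (0 : ℝ) 1 := ⟨(htk k hk').1.trans hs.1,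
      hs.2.trans (by rw [div_le_one (by positivity)]; exact hk1)⟩
    have h1 := (hT _ (hxR s hs') _ (hxR _ (htk k hk'))).1
    have h2 : |x s - x ((k : ℝ) / 2 ^ (2 * n))| ≤ 2 * w ^ 2 * Real.sqrt n := by
      have hd : |s - (k : ℝ) / 2 ^ (2 * n)| ≤ (2 : ℝ) ^ (-((2 * n : ℕ) : ℝ)) := by
        rw [Real.rpow_neg (by norm_num), Real.rpow_natCast, ← one_div,
          abs_of_nonneg (by linarith [hs.1])]
        have := hs.2
        rw [add_div] at this
        linarith
      refine (hmod (2 * n) (by omega) s hs' _ (htk k hk') hd).trans ?_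
      have e1 : (2 : ℝ) ^ (-H * ((2 * n : ℕ) : ℝ)) = w ^ 2 := by
        rw [hw, ← Real.rpow_natCast, ← Real.rpow_mul (by norm_num)]
        congr 1; push_cast; ring
      rw [e1, mul_comm 2 (w ^ 2), mul_assoc (w ^ 2)]
      refine mul_le_mul_of_nonneg_left ?_ (sq_nonneg w)
      rw [Real.sqrt_le_left (by positivity), mul_pow, Real.sq_sqrt (by positivity)]
      push_cast
      nlinarith [Real.log_two_lt_d9, Nat.cast_nonneg (α := ℝ) n]
    have h3 : (x s - x ((k : ℝ) / 2 ^ (2 * n))) ^ 2 ≤ (2 * w ^ 2 * Real.sqrt n) ^ 2 :=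
      sq_le_sq' (abs_le.1 h2).1 (abs_le.1 h2).2
    calc _ = |g (x s) - g (x ((k : ℝ) / 2 ^ (2 * n)))
          - deriv g (x ((k : ℝ) / 2 ^ (2 * n))) * (x s - x ((k : ℝ) / 2 ^ (2 * n)))| := by
            congr 1; simp only [hc]; ring
      _ ≤ _ := h1.trans (mul_le_mul_of_nonneg_left h3 hL.le)
  obtain ⟨hplo, hphi⟩ := sum_sq_perturb he he1 hpert
  rw [Finset.card_range] at hplo hphi
  -- on each block of length `2 ^ (-n)` the weights are close to their mean
  set W : ℕ → ℝ := fun i =>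
    2 ^ n * ∫ s in ((i : ℝ) / 2 ^ n)..((i + 1 : ℕ) : ℝ) / 2 ^ n, deriv g (x s) ^ 2 with hW
  have hblk : ∀ i : ℕ, i < 2 ^ n → Set.Icc ((i : ℝ) / 2 ^ n) (((i + 1 : ℕ) : ℝ) / 2 ^ n)
      ⊆ Set.Icc (0 : ℝ) 1 := fun i hi =>
    Set.Icc_subset_Icc (by positivity) (by
      rw [div_le_one hQ]; exact_mod_cast Nat.succ_le_of_lt hi)
  have hble : ∀ i : ℕ, (i : ℝ) / 2 ^ n ≤ ((i + 1 : ℕ) : ℝ) / 2 ^ n := fun i => by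
    gcongr; simp
  have hlen : ∀ i : ℕ, ((i + 1 : ℕ) : ℝ) / 2 ^ n - (i : ℝ) / 2 ^ n = 1 / 2 ^ n := fun i => by
    push_cast; ring
  have hWnn : ∀ i < 2 ^ n, 0 ≤ W i := fun i _ =>
    mul_nonneg hQ.le (intervalIntegral.integral_nonneg (hble i) fun s _ => sq_nonneg _)
  have hWsum : ∑ i ∈ Finset.range (2 ^ n), W i = 2 ^ n * I := by
    rw [← Finset.mul_sum, intervalIntegral.sum_integral_adjacent_intervals
      (a := fun i : ℕ => (i : ℝ) / 2 ^ n)]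
    · simp [hI]
    · intro i hi
      refine ContinuousOn.intervalIntegrable ?_
      rw [Set.uIcc_of_le (hble i)]
      exact hqc.mono (hblk i hi)
  have hqW : ∀ i < 2 ^ n, ∀ j < 2 ^ n, |c (2 ^ n * i + j) ^ 2 - W i| ≤ 2 * L * e := by
    intro i hi j hj
    have ht : ((2 ^ n * i + j : ℕ) : ℝ) / 2 ^ (2 * n)
        ∈ Set.Icc ((i : ℝ) / 2 ^ n) (((i + 1 : ℕ) : ℝ) / 2 ^ n) := by
      have hj' : (j : ℝ) ≤ 2 ^ n := by exact_mod_cast hj.le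
      rw [hQ2, ← div_div]
      constructor
      · gcongr
        rw [le_div_iff₀ hQ]; push_cast; nlinarith [Nat.cast_nonneg (α := ℝ) j]
      · gcongr
        rw [div_le_iff₀ hQ]; push_cast; nlinarith
    have h1 := abs_mul_sub_integral_le (hble i) (hqc.mono (hblk i hi))
      (t := ((2 ^ n * i + j : ℕ) : ℝ) / 2 ^ (2 * n)) (M := 2 * L * e) (by
        intro s hs
        refine (hT _ (hxR s (hblk i hi hs)) _ (hxR _ (hblk i hi ht))).2.trans ?_
        have hd : |s - ((2 ^ n * i + j : ℕ) : ℝ) / 2 ^ (2 * n)| ≤ 1 / 2 ^ n := by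
          rw [← hlen i, abs_le]
          constructor <;> linarith [hs.1, hs.2, ht.1, ht.2]
        have := mul_le_mul_of_nonneg_left
          (hmod' n (by omega) s (hblk i hi hs) _ (hblk i hi ht) hd) hL.le
        linarith)
    rw [hlen] at h1
    rw [abs_sub_comm]
    have h2 := mul_le_mul_of_nonneg_left h1 hQ.le
    rw [← abs_of_pos hQ, ← abs_mul, abs_of_pos hQ, mul_sub] at h2
    refine (le_of_eq ?_).trans (h2.trans (le_of_eq ?_))
    · congr 2
      simp only [hc]
      field_simp
    · field_simp
  obtain ⟨hblo, hbhi⟩ := weighted_blocks_bound (m := 2 ^ n)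
    (q := fun i j => c (2 ^ n * i + j) ^ 2)
    (y := fun i j => vartheta y (2 * n) (2 ^ n * i + j)) (W := W) (η := 2 * L * e)
    (c := (2 : ℝ) ^ ((n : ℝ) * (4 * H - 3))) (by positivity) (by positivity) hWnn hqW
    (fun i hi => (hy n (by omega) i hi).1) (fun i hi => (hy n (by omega) i hi).2)
  have hsum : ∑ i ∈ Finset.range (2 ^ n), ∑ j ∈ Finset.range (2 ^ n),
      c (2 ^ n * i + j) ^ 2 * vartheta y (2 * n) (2 ^ n * i + j) ^ 2
      = ∑ k ∈ Finset.range (2 ^ (2 * n)), (c k * vartheta y (2 * n) k) ^ 2 := by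
    rw [two_mul, pow_add, sum_range_mul_eq]
    simp only [mul_pow, ← two_mul]
  have hNc : (2 : ℝ) ^ ((n : ℝ) * (4 * H - 3)) = 2 ^ n * (2 : ℝ) ^ ((n : ℝ) * (4 * H - 4)) := by
    rw [← Real.rpow_natCast, ← Real.rpow_add (by norm_num)]
    congr 1; ring
  rw [hsum, hWsum, hNc] at hblo hbhi
  push_cast at hblo hbhi
  have hN0 : (0 : ℝ) ≤ (2 : ℝ) ^ ((n : ℝ) * (4 * H - 4)) := by positivity
  have hA1 := mul_le_mul_of_nonneg_left hplo hN0
  have hA2 := mul_le_mul_of_nonneg_left hphi hN0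
  rw [mul_sub, hscale] at hA1
  rw [mul_add, mul_left_comm _ (2 : ℝ), hscale] at hA2
  have key := multiplicative_bounds_of_additive he he1 (deltaSeq_nonneg hcH.le n) hδ1 htauH hpos hL
    (A := (2 : ℝ) ^ ((n : ℝ) * (4 * H - 4)) *
      ∑ k ∈ Finset.range (2 ^ (2 * n)), vartheta v (2 * n) k ^ 2)
    (P := (2 : ℝ) ^ ((n : ℝ) * (4 * H - 4)) *
      ∑ k ∈ Finset.range (2 ^ (2 * n)), (c k * vartheta y (2 * n) k) ^ 2)
    (le_of_mul_le_mul_left (by linarith) hQ) (le_of_mul_le_mul_left (by linarith) hQ)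
    (by linarith) (by linarith)
  rwa [mul_assoc _ w (Real.sqrt n)]
end

section
/- Let H ∈ (0,1), let g ∈ C²(ℝ), let x : [0,1] → ℝ be continuous, and set v(t) := ∫₀ᵗ g(x(s)) ds and I := ∫₀¹ (g'(x(s)))² ds. Assume I > 0 and that there exist constants τ_H > 0, c_H > 0, λ_x > 0 and n₀ ∈ ℕ such that for all n ≥ n₀: (1 − δ_n)² (1 − ε_n) τ_H I ≤ 2^{n(4H−4)} ‖ϑ̄^v_{2n}‖²_{ℓ₂} ≤ (1 + δ_n)² (1 + ε_n) τ_H I, where δ_n := c_H · 2^{−n/2} √(n log 2 + 2 log n) and ε_n := λ_x · 2^{−nH} √n. Then | 𝓡̂_{2n}( v / √(τ_H I) ) − H | = O( n^{−1/2} · 2^{−(H ∧ 1/2) n} ) as n → ∞. -/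
open MeasureTheory ProbabilityTheory Filter

/-- The estimator `𝓡̂_n(f) = 1 - (1/n) log₂ √(Σ_k (ϑ^f_{n,k})²)`. -/
noncomputable def Rhat (n : ℕ) (f : ℝ → ℝ) : ℝ :=
  1 - (1 / (n : ℝ)) * Real.logb 2 (Real.sqrt (∑ k ∈ Finset.range (2 ^ n), (vartheta f n k) ^ 2))

lemma vartheta_div_const (f : ℝ → ℝ) (c : ℝ) (n k : ℕ) :
    vartheta (fun t => f t / c) n k = vartheta f n k / c := by
  unfold vartheta
  ring

/-- If the squared norm of the coefficients at level `2n` is `2^{n(4-4H)} T P`, then rescaling by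
`√T` makes the estimation error exactly `|log P| / (4 n log 2)`. -/
lemma Rhat_two_mul_div_sqrt (f : ℝ → ℝ) (H T P : ℝ) (n : ℕ) (hn : 0 < n) (hT : 0 < T) (hP : 0 < P)
    (hS : (2 : ℝ) ^ ((n : ℝ) * (4 * H - 4)) *
      ∑ k ∈ Finset.range (2 ^ (2 * n)), (vartheta f (2 * n) k) ^ 2 = P * T) :
    Rhat (2 * n) (fun t => f t / Real.sqrt T) - H = -(Real.log P / (4 * n * Real.log 2)) := by
  have hsum : ∑ k ∈ Finset.range (2 ^ (2 * n)),
      (vartheta (fun t => f t / Real.sqrt T) (2 * n) k) ^ 2 =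
      (2 : ℝ) ^ (-((n : ℝ) * (4 * H - 4))) * P := by
    simp only [vartheta_div_const, div_pow, Real.sq_sqrt hT.le]
    rw [← Finset.sum_div, Real.rpow_neg (by norm_num)]
    have h2 : (2 : ℝ) ^ ((n : ℝ) * (4 * H - 4)) ≠ 0 := by positivity
    rw [div_eq_iff hT.ne', mul_assoc, ← hS, inv_mul_cancel_left₀ h2]
  have hn' : (n : ℝ) ≠ 0 := by positivity
  have hl : Real.log 2 ≠ 0 := (Real.log_pos (by norm_num)).ne'
  unfold Rhat
  rw [hsum, Real.logb, Real.log_sqrt (by positivity),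
    Real.log_mul (by positivity) hP.ne', Real.log_rpow (by norm_num)]
  push_cast
  field_simp
  ring

lemma abs_log_le_two_mul {P a : ℝ} (ha : a ≤ 1 / 2) (h : |P - 1| ≤ a) : |Real.log P| ≤ 2 * a := by
  obtain ⟨h1, h2⟩ := abs_le.1 h
  have hP : 0 < P := by linarith
  have hu := Real.log_le_sub_one_of_pos hP
  have hl := Real.one_sub_inv_le_log_of_pos hP
  have hi : P⁻¹ ≤ 1 + 2 * a := by
    rw [inv_le_iff_one_le_mul₀ hP]
    nlinarith
  exact abs_le.2 ⟨by linarith, by linarith⟩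

lemma tendsto_sqrt_mul_two_rpow_neg {m : ℝ} (hm : 0 < m) :
    Tendsto (fun n : ℕ => Real.sqrt n * (2 : ℝ) ^ (-m * n)) atTop (nhds 0) := by
  have h := (tendsto_rpow_mul_exp_neg_mul_atTop_nhds_zero (1 / 2) (Real.log 2 * m)
    (mul_pos (Real.log_pos (by norm_num)) hm)).comp tendsto_natCast_atTop_atTop
  refine h.congr fun n => ?_
  simp only [Function.comp]
  rw [Real.sqrt_eq_rpow, Real.rpow_def_of_pos (by norm_num : (0 : ℝ) < 2)]
  ring_nf

lemma deltaSeq_le {c m : ℝ} (hc : 0 ≤ c) (hm : m ≤ 1 / 2) (n : ℕ) :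
    deltaSeq c n ≤ 2 * c * (Real.sqrt n * (2 : ℝ) ^ (-m * n)) := by
  have hs : Real.sqrt ((n : ℝ) * Real.log 2 + 2 * Real.log n) ≤ 2 * Real.sqrt n := by
    rw [show 2 * Real.sqrt (n : ℝ) = Real.sqrt (4 * n) by
      rw [Real.sqrt_mul (by norm_num), show (4 : ℝ) = 2 ^ 2 by norm_num,
        Real.sqrt_sq (by norm_num)]]
    apply Real.sqrt_le_sqrt
    have h2 : Real.log 2 ≤ 1 := by linarith [Real.log_two_lt_d9]
    have hn := Real.log_le_self (Nat.cast_nonneg (α := ℝ) n)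
    nlinarith [Nat.cast_nonneg (α := ℝ) n]
  have hp : (2 : ℝ) ^ (-(n : ℝ) / 2) ≤ (2 : ℝ) ^ (-m * n) :=
    Real.rpow_le_rpow_of_exponent_le (by norm_num)
      (by nlinarith [Nat.cast_nonneg (α := ℝ) n])
  calc deltaSeq c n ≤ c * (2 : ℝ) ^ (-m * n) * (2 * Real.sqrt n) := by
        unfold deltaSeq
        gcongr
    _ = _ := by ring

lemma one_sub_seven_mul_le {d e b : ℝ} (hd : 0 ≤ d) (he : 0 ≤ e) (hdb : d ≤ b) (heb : e ≤ b)
    (hb : b ≤ 1) : 1 - 7 * b ≤ (1 - d) ^ 2 * (1 - e) := by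
  have h1 : 1 - 2 * d ≤ (1 - d) ^ 2 := by nlinarith
  have h2 : (1 - d) ^ 2 ≤ 1 := by nlinarith
  nlinarith

lemma le_one_add_seven_mul {d e b : ℝ} (hd : 0 ≤ d) (he : 0 ≤ e) (hdb : d ≤ b) (heb : e ≤ b)
    (hb : b ≤ 1) : (1 + d) ^ 2 * (1 + e) ≤ 1 + 7 * b := by
  have h1 : (1 + d) ^ 2 ≤ 1 + 3 * b := by nlinarith
  have h2 : (1 + d) ^ 2 * (1 + e) ≤ (1 + 3 * b) * (1 + b) := by
    gcongr
    linarith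
  nlinarith

/-- Lemma 2.6 (pathwise version): given the two-sided bounds for
`2^{n(4H-4)} ‖ϑ̄^v_{2n}‖²`, the rescaled estimator converges at rate
`O(n^{-1/2} 2^{-(H ∧ 1/2)n})`, where `v(t) = ∫₀ᵗ g(x(s)) ds` and `I = ∫₀¹ g'(x(s))² ds`. -/
theorem stmt8 (H : ℝ) (hH : H ∈ Set.Ioo (0 : ℝ) 1)
    (g : ℝ → ℝ) (hg : ContDiff ℝ 2 g)
    (x : ℝ → ℝ) (hxc : ContinuousOn x (Set.Icc 0 1))
    (hpos : 0 < ∫ s in (0 : ℝ)..1, (deriv g (x s)) ^ 2)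
    (tauH cH lx : ℝ) (htauH : 0 < tauH) (hcH : 0 < cH) (hlx : 0 < lx) (n₀ : ℕ)
    (hv : ∀ n ≥ n₀,
      (1 - deltaSeq cH n) ^ 2 * (1 - lx * (2 : ℝ) ^ (-(n : ℝ) * H) * Real.sqrt n) *
          (tauH * ∫ s in (0 : ℝ)..1, (deriv g (x s)) ^ 2) ≤
        (2 : ℝ) ^ ((n : ℝ) * (4 * H - 4)) *
          ∑ k ∈ Finset.range (2 ^ (2 * n)),
            (vartheta (fun t => ∫ s in (0 : ℝ)..t, g (x s)) (2 * n) k) ^ 2 ∧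
      (2 : ℝ) ^ ((n : ℝ) * (4 * H - 4)) *
          ∑ k ∈ Finset.range (2 ^ (2 * n)),
            (vartheta (fun t => ∫ s in (0 : ℝ)..t, g (x s)) (2 * n) k) ^ 2 ≤
        (1 + deltaSeq cH n) ^ 2 * (1 + lx * (2 : ℝ) ^ (-(n : ℝ) * H) * Real.sqrt n) *
          (tauH * ∫ s in (0 : ℝ)..1, (deriv g (x s)) ^ 2)) :
    ∃ C : ℝ, ∀ᶠ n : ℕ in atTop,
      |Rhat (2 * n) (fun t => (∫ s in (0 : ℝ)..t, g (x s)) /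
          Real.sqrt (tauH * ∫ s in (0 : ℝ)..1, (deriv g (x s)) ^ 2)) - H| ≤
        C * ((n : ℝ) ^ (-(1 : ℝ) / 2) * (2 : ℝ) ^ (-(min H (1 / 2)) * n)) := by
  obtain ⟨hH0, -⟩ := hH
  set T := tauH * ∫ s in (0 : ℝ)..1, (deriv g (x s)) ^ 2 with hTdef
  have hT : 0 < T := mul_pos htauH hpos
  set m := min H (1 / 2) with hmdef
  have hm : 0 < m := lt_min hH0 (by norm_num)
  set A := 2 * cH + lx with hA
  have hA0 : 0 < A := by positivity
  refine ⟨14 * A / (4 * Real.log 2), ?_⟩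
  have hsmall : ∀ᶠ n : ℕ in atTop, Real.sqrt n * (2 : ℝ) ^ (-m * n) < 1 / (14 * A) :=
    (tendsto_sqrt_mul_two_rpow_neg hm).eventually_lt_const (by positivity)
  filter_upwards [hsmall, eventually_ge_atTop n₀, eventually_gt_atTop 0] with n hr hn₀ hn
  set r := Real.sqrt n * (2 : ℝ) ^ (-m * n) with hrdef
  have hr0 : 0 ≤ r := by positivity
  have hAr : 7 * (A * r) ≤ 1 / 2 := by
    rw [lt_div_iff₀ (by positivity)] at hr
    linarith
  have hd : deltaSeq cH n ≤ A * r :=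
    (deltaSeq_le hcH.le (min_le_right _ _) n).trans (by gcongr; linarith)
  have he : lx * (2 : ℝ) ^ (-(n : ℝ) * H) * Real.sqrt n ≤ A * r := by
    have hp : (2 : ℝ) ^ (-(n : ℝ) * H) ≤ (2 : ℝ) ^ (-m * n) :=
      Real.rpow_le_rpow_of_exponent_le (by norm_num)
        (by nlinarith [Nat.cast_nonneg (α := ℝ) n, min_le_left H (1 / 2)])
    calc _ ≤ lx * (2 : ℝ) ^ (-m * n) * Real.sqrt n := by gcongr
      _ = lx * r := by rw [hrdef]; ring
      _ ≤ A * r := by gcongr; linarith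
  have he0 : 0 ≤ lx * (2 : ℝ) ^ (-(n : ℝ) * H) * Real.sqrt n := by positivity
  have hd0 := deltaSeq_nonneg hcH.le n
  obtain ⟨hlow, hup⟩ := hv n hn₀
  rw [← le_div_iff₀ hT] at hlow
  rw [← div_le_iff₀ hT] at hup
  have hlow' := (one_sub_seven_mul_le hd0 he0 hd he (by linarith)).trans hlow
  have hup' := hup.trans (le_one_add_seven_mul hd0 he0 hd he (by linarith))
  have hlog := abs_log_le_two_mul hAr (abs_le.2 ⟨by linarith, by linarith⟩)
  rw [Rhat_two_mul_div_sqrt _ H T _ n hn hT (by linarith) (div_mul_cancel₀ _ hT.ne').symm,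
    abs_neg, abs_div]
  have hl : 0 < Real.log 2 := Real.log_pos (by norm_num)
  have hnpos : (0 : ℝ) < n := by exact_mod_cast hn
  rw [abs_of_pos (by positivity : 0 < 4 * (n : ℝ) * Real.log 2)]
  have hsqrt : (n : ℝ) ^ (-(1 : ℝ) / 2) = Real.sqrt n / n := by
    rw [Real.sqrt_div_self', show -(1 : ℝ) / 2 = -(1 / 2) by norm_num,
      Real.rpow_neg hnpos.le, Real.sqrt_eq_rpow, one_div, one_div]
  calc _ ≤ 2 * (7 * (A * r)) / (4 * n * Real.log 2) := by gcongr
    _ = _ := by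
      rw [hsqrt, hrdef]
      field_simp
      ring
end

section
/- Fix m ∈ ℕ, α₀ > 0 and α₁,…,α_m ≥ 0, let n > m + 1, and let f : [0,1] → ℝ satisfy Σ_{j=0}^{2^k−1} (ϑ^f_{k,j})² > 0 for every k ∈ {n−m−1, …, n}. Then the function F : (0,∞) → ℝ, F(η) := Σ_{k=n−m}^{n} α_{n−k}( 𝓡̂_k(η f) − 𝓡̂_{k−1}(η f) )², attains its infimum at exactly one point η^s_n ∈ (0,∞); in particular the sequential scaling factor η^s_n and the sequential scale estimate 𝓡^s_n(f) := 𝓡̂_n(η^s_n f) are well defined. -/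
open MeasureTheory ProbabilityTheory Filter

/-- A weighted sum of squares of affine functions, with positive leading coefficient, has the form
`K + A (x - x₀)²`. -/
theorem exists_sum_mul_sq_affine_eq {ι : Type*} (s : Finset ι) (w d c : ι → ℝ)
    (h : 0 < ∑ k ∈ s, w k * c k ^ 2) :
    ∃ K x₀ : ℝ, ∀ x : ℝ, ∑ k ∈ s, w k * (d k + c k * x) ^ 2 =
      K + (∑ k ∈ s, w k * c k ^ 2) * (x - x₀) ^ 2 := by
  set A := ∑ k ∈ s, w k * c k ^ 2 with hA
  set B := ∑ k ∈ s, w k * d k * c k with hB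
  set C := ∑ k ∈ s, w k * d k ^ 2 with hC
  refine ⟨C - B ^ 2 / A, -(B / A), fun x => ?_⟩
  have hsum : ∑ k ∈ s, w k * (d k + c k * x) ^ 2 = C + 2 * x * B + x ^ 2 * A := by
    rw [hA, hB, hC, Finset.mul_sum, Finset.mul_sum, ← Finset.sum_add_distrib,
      ← Finset.sum_add_distrib]
    exact Finset.sum_congr rfl fun k _ => by ring
  rw [hsum]
  field_simp
  ring

theorem vartheta_const_mul (f : ℝ → ℝ) (η : ℝ) (n k : ℕ) :
    vartheta (fun t => η * f t) n k = η * vartheta f n k := by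
  simp only [vartheta]
  ring

theorem Rhat_const_mul {n : ℕ} {f : ℝ → ℝ} {η : ℝ} (hη : 0 < η)
    (hpos : 0 < ∑ k ∈ Finset.range (2 ^ n), (vartheta f n k) ^ 2) :
    Rhat n (fun t => η * f t) = Rhat n f - 1 / (n : ℝ) * Real.logb 2 η := by
  simp only [Rhat, vartheta_const_mul, mul_pow, ← Finset.mul_sum]
  rw [Real.sqrt_mul (sq_nonneg η), Real.sqrt_sq hη.le,
    Real.logb_mul hη.ne' (Real.sqrt_pos.2 hpos).ne']
  ring

/-- Well-definedness of the sequential scaling factor: the function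
`F(η) = Σ_{k=n-m}^n α_{n-k} (𝓡̂_k(ηf) − 𝓡̂_{k-1}(ηf))²` on `(0,∞)` attains its
infimum at exactly one point `η^s_n ∈ (0,∞)`. -/
theorem stmt14 (m : ℕ) (a : ℕ → ℝ) (ha0 : 0 < a 0) (ha : ∀ j ≤ m, 0 ≤ a j)
    (n : ℕ) (hn : m + 1 < n) (f : ℝ → ℝ)
    (hpos : ∀ k : ℕ, n - m - 1 ≤ k → k ≤ n →
      0 < ∑ j ∈ Finset.range (2 ^ k), (vartheta f k j) ^ 2) :
    ∃! η : ℝ, 0 < η ∧ ∀ η' : ℝ, 0 < η' →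
      (∑ k ∈ Finset.Icc (n - m) n, a (n - k) *
          (Rhat k (fun t => η * f t) - Rhat (k - 1) (fun t => η * f t)) ^ 2) ≤
        (∑ k ∈ Finset.Icc (n - m) n, a (n - k) *
          (Rhat k (fun t => η' * f t) - Rhat (k - 1) (fun t => η' * f t)) ^ 2) := by
  have hF : ∀ η : ℝ, 0 < η → (∑ k ∈ Finset.Icc (n - m) n, a (n - k) *
      (Rhat k (fun t => η * f t) - Rhat (k - 1) (fun t => η * f t)) ^ 2) =
      ∑ k ∈ Finset.Icc (n - m) n, a (n - k) * ((Rhat k f - Rhat (k - 1) f) +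
        (1 / ((k - 1 : ℕ) : ℝ) - 1 / (k : ℝ)) * Real.logb 2 η) ^ 2 := by
    intro η hη
    refine Finset.sum_congr rfl fun k hk => ?_
    rw [Finset.mem_Icc] at hk
    rw [Rhat_const_mul hη (hpos k (by omega) hk.2),
      Rhat_const_mul hη (hpos (k - 1) (by omega) (by omega))]
    ring
  have hA : 0 < ∑ k ∈ Finset.Icc (n - m) n,
      a (n - k) * (1 / ((k - 1 : ℕ) : ℝ) - 1 / (k : ℝ)) ^ 2 := by
    refine Finset.sum_pos' (fun k hk => ?_) ⟨n, by simp, ?_⟩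
    · rw [Finset.mem_Icc] at hk
      exact mul_nonneg (ha _ (by omega)) (sq_nonneg _)
    · rw [Nat.sub_self]
      have h₁ : (0 : ℝ) < ((n - 1 : ℕ) : ℝ) := by exact_mod_cast (by omega : 0 < n - 1)
      have h₂ : ((n - 1 : ℕ) : ℝ) < (n : ℝ) := by exact_mod_cast (by omega : n - 1 < n)
      exact mul_pos ha0 (pow_pos (sub_pos.2 (one_div_lt_one_div_of_lt h₁ h₂)) 2)
  obtain ⟨K, x₀, hK⟩ := exists_sum_mul_sq_affine_eq (Finset.Icc (n - m) n) (fun k => a (n - k))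
    (fun k => Rhat k f - Rhat (k - 1) f) (fun k => 1 / ((k - 1 : ℕ) : ℝ) - 1 / (k : ℝ)) hA
  have hx₀ : (0 : ℝ) < 2 ^ x₀ := Real.rpow_pos_of_pos two_pos x₀
  have hlog : Real.logb 2 ((2 : ℝ) ^ x₀) = x₀ := Real.logb_rpow two_pos (by norm_num)
  refine ⟨2 ^ x₀, ⟨hx₀, fun η' hη' => ?_⟩, fun η ⟨hη, hmin⟩ => ?_⟩
  · rw [hF _ hx₀, hF _ hη', hK, hK, hlog, sub_self]
    have := mul_nonneg hA.le (sq_nonneg (Real.logb 2 η' - x₀))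
    linarith
  · have h := hmin _ hx₀
    rw [hF _ hx₀, hF _ hη, hK, hK, hlog, sub_self] at h
    have hsq : (Real.logb 2 η - x₀) ^ 2 ≤ 0 := by
      by_contra! hlt
      have := mul_pos hA hlt
      linarith
    have heq : Real.logb 2 η = x₀ := by
      have := pow_eq_zero_iff (two_ne_zero) |>.1 (le_antisymm hsq (sq_nonneg _))
      linarith
    rw [← heq, Real.rpow_logb two_pos (by norm_num) hη]
end
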